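/- The set of subfields F of the algebraic closure of ℚ such that the ring of integers 𝒪_F, i.e., the integral closure of ℤ in F, is definable by a first-order formula in the language of rings with parameters from F, is a meager subset of the space 𝓔 of all subfields of the algebraic closure of ℚ. -/

import Mathlib

open FirstOrder Topology

noncomputable section

/-- `Q̄`, the algebraic closure of `ℚ`. -/
abbrev Qbar : Type := AlgebraicClosure ℚ

/-- `Prop` with the discrete two-point topology. -/
def propDiscrete : TopologicalSpace Prop := ⊥

/-- The product topology on the powerset `2^Q̄`, identified with `Set Q̄ = Q̄ → Prop`,
where each factor `Prop` carries the discrete two-point topology. -/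
def powersetTopology : TopologicalSpace (Set Qbar) :=
  @Pi.topologicalSpace Qbar (fun _ => Prop) (fun _ => propDiscrete)

/-- The space `𝓔` of all subfields of `Q̄`, with the subspace topology induced from `2^Q̄`
via the identification of a subfield with its underlying set of elements. -/
instance subfieldTopology : TopologicalSpace (Subfield Qbar) :=
  powersetTopology.induced (fun F => (F : Set Qbar))

/-- A subset `s` of a field `F` is definable (with parameters) if it is the solution set in `F`
of a first-order formula in the language of rings with parameters from `F`. -/
def DefinableIn (F : Type*) [Field F] (s : Set F) : Prop :=
  letI := FirstOrder.Ring.compatibleRingOfRing F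
  Set.Definable₁ (Set.univ : Set F) FirstOrder.Language.ring s

/-- The subset `ℤ` of a field `F`. -/
def intSet (F : Type*) [Field F] : Set F := Set.range (Int.cast : ℤ → F)

/-- The ring of integers `𝒪_F` of `F`: the integral closure of `ℤ` in `F`. -/
def ringOfIntegers (F : Type*) [Field F] : Set F := {x : F | IsIntegral ℤ x}

section

universe u

open Polynomial

theorem exists_newton_interpolation {R : Type*} [CommRing R] (g : R[X]) (s : ℕ → R) (m : ℕ) :
    ∃ (γ : ℕ → R) (h : R[X]), g = ∑ l ∈ Finset.range m, C (γ l) * ∏ u ∈ Finset.range l, (X - C (s u))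
      + h * ∏ u ∈ Finset.range m, (X - C (s u)) := by
  induction m with
  | zero => exact ⟨0, g, by simp⟩
  | succ m ih =>
    obtain ⟨γ, h, e⟩ := ih
    refine ⟨Function.update γ m (h.eval (s m)), h /ₘ (X - C (s m)), ?_⟩
    have e1 : h = C (h.eval (s m)) + (X - C (s m)) * (h /ₘ (X - C (s m))) := by
      rw [← modByMonic_X_sub_C_eq_C_eval, modByMonic_add_div]
    have e2 : ∑ l ∈ Finset.range m, C (Function.update γ m (h.eval (s m)) l) *
        ∏ u ∈ Finset.range l, (X - C (s u)) =
        ∑ l ∈ Finset.range m, C (γ l) * ∏ u ∈ Finset.range l, (X - C (s u)) := by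
      refine Finset.sum_congr rfl fun l hl => ?_
      rw [Function.update_of_ne (Finset.mem_range.1 hl).ne]
    rw [Finset.sum_range_succ, Finset.prod_range_succ, Function.update_self, e2, add_assoc]
    conv_lhs => rw [e, e1]
    ring

theorem pow_dvd_det_eval {R : Type*} [CommRing R] {M : ℕ} (g : Fin M → R[X]) (s : Fin M → R)
    (π : R) (hs : ∀ r, π ∣ s r) :
    π ^ (∑ l : Fin M, (l : ℕ)) ∣ (Matrix.of fun r l => (g l).eval (s r)).det := by
  classical
  set s' : ℕ → R := fun n => if h : n < M then s ⟨n, h⟩ else 0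
  have hs' : ∀ n, π ∣ s' n := by
    intro n
    by_cases h : n < M
    · simpa [s', h] using hs _
    · simp [s', h]
  have hss (r : Fin M) : s' r = s r := by simp [s']
  choose γ h e using fun l => exists_newton_interpolation (g l) s' M
  have key : (Matrix.of fun r l => (g l).eval (s r)) =
      (Matrix.of fun r l : Fin M => ∏ u ∈ Finset.range l, (s r - s' u)) *
      (Matrix.of fun l k : Fin M => γ k l) := by
    ext r k
    rw [Matrix.mul_apply]
    simp only [Matrix.of_apply]
    conv_lhs => rw [e k]
    rw [eval_add, eval_mul, eval_prod, eval_finsetSum, Finset.prod_eq_zero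
      (i := (r : ℕ)) (by simp) (by simp [hss]), mul_zero, add_zero, Finset.sum_range]
    refine Finset.sum_congr rfl fun l _ => ?_
    simp [eval_mul, eval_prod, mul_comm]
  rw [key, Matrix.det_mul, Matrix.det_of_isLowerTriangular]
  · refine Dvd.dvd.mul_right ?_ _
    rw [← Finset.prod_pow_eq_pow_sum]
    refine Finset.prod_dvd_prod_of_dvd _ _ fun l _ => ?_
    rw [Matrix.of_apply]
    calc π ^ (l : ℕ) = ∏ u ∈ Finset.range l, π := by simp
      _ ∣ _ := Finset.prod_dvd_prod_of_dvd _ _ fun u _ => dvd_sub (hs _) (hs' _)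
  · intro i j hij
    have : i < j := hij
    rw [Matrix.of_apply]
    exact Finset.prod_eq_zero (i := (i : ℕ)) (by simpa using this) (by simp [hss])

/-- Evaluation of a bivariate polynomial along a ring homomorphism on the coefficients. -/
def ev {A B : Type*} [CommRing A] [CommRing B] (τ : A →+* B) (t y : B) : A[X][X] →+* B :=
  eval₂RingHom (eval₂RingHom τ t) y

theorem ev_apply {A B : Type*} [CommRing A] [CommRing B] (τ : A →+* B) (t y : B) (f : A[X][X]) :
    ev τ t y f = (f.map (eval₂RingHom τ t)).eval y := by
  simp [ev, eval_map]

theorem ev_C {A B : Type*} [CommRing A] [CommRing B] (τ : A →+* B) (t y : B) (f : A[X]) :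
    ev τ t y (C f) = f.eval₂ τ t := by
  simp [ev]

theorem ev_X {A B : Type*} [CommRing A] [CommRing B] (τ : A →+* B) (t y : B) :
    ev τ t y X = y := by
  simp [ev]

theorem map_ev {A B B' : Type*} [CommRing A] [CommRing B] [CommRing B'] (φ : B →+* B')
    (τ : A →+* B) (t y : B) (f : A[X][X]) :
    φ (ev τ t y f) = ev (φ.comp τ) (φ t) (φ y) f := by
  simp only [ev, coe_eval₂RingHom, hom_eval₂]
  congr 1
  ext x <;> simp

theorem ev_map {A A' B : Type*} [CommRing A] [CommRing A'] [CommRing B] (φ : A →+* A')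
    (τ : A' →+* B) (t y : B) (f : A[X][X]) :
    ev τ t y (f.map (mapRingHom φ)) = ev (τ.comp φ) t y f := by
  simp only [ev, coe_eval₂RingHom, eval₂_map]
  congr 1
  ext x <;> simp

/-- Points of the curve `f = 0` with fixed reduction modulo `p` lie on a `p`-adic analytic arc. -/
theorem exists_approx_root {O : Type*} [CommRing O] (f : O[X][X]) (a b : O[X]) (δ p : O)
    (hδ : a * f.map (evalRingHom 0) + b * derivative (f.map (evalRingHom 0)) = C δ)
    (hp : IsCoprime p δ) (E : ℕ) (t₀ x₀ : O) (ht₀ : p ∣ t₀) (h₀ : ev (RingHom.id O) t₀ x₀ f = 0) :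
    ∃ η : O[X], ∀ t x : O, p ∣ t → ev (RingHom.id O) t x f = 0 → p ∣ x - x₀ →
      p ^ E ∣ x - η.eval t := by
  set I : Ideal O[X] := Ideal.span {C p ^ E, X ^ E} with hI
  set A := O[X] ⧸ I
  let mk : O[X] →+* A := Ideal.Quotient.mk I
  let P : A[X] := f.map mk
  have nilp : IsNilpotent (mk (C p)) := ⟨E, by
    rw [← map_pow]; exact Ideal.Quotient.eq_zero_iff_mem.2 (Ideal.subset_span (by simp))⟩
  have nilX : IsNilpotent (mk X) := ⟨E, by
    rw [← map_pow]; exact Ideal.Quotient.eq_zero_iff_mem.2 (Ideal.subset_span (by simp))⟩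
  have key0 : ∀ q : O[X], IsNilpotent (mk q) ↔ IsNilpotent (mk (C (q.eval 0))) := by
    intro q
    have : X ∣ q - C (q.eval 0) := by
      rw [X_dvd_iff]; simp [coeff_zero_eq_eval_zero]
    obtain ⟨r, hr⟩ := this
    have h1 : mk q = mk (C (q.eval 0)) + mk X * mk r := by
      rw [← map_mul, ← hr, ← map_add]; ring_nf
    have h2 : IsNilpotent (mk X * mk r) := (Commute.all _ _).isNilpotent_mul_right nilX
    constructor
    · intro h
      have : mk (C (q.eval 0)) = mk q - mk X * mk r := by rw [h1]; ring
      rw [this]; exact (Commute.all _ _).isNilpotent_sub h h2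
    · intro h
      rw [h1]; exact (Commute.all _ _).isNilpotent_add h h2
  have nilmul : ∀ c : O, p ∣ c → IsNilpotent (mk (C c)) := by
    rintro c ⟨d, rfl⟩
    rw [C_mul, map_mul]
    exact (Commute.all _ _).isNilpotent_mul_right nilp
  have evdiff : ∀ t x : O, p ∣ t → p ∣ ev (RingHom.id O) t x f - (f.map (evalRingHom 0)).eval x := by
    intro t x ht
    have : (f.map (evalRingHom 0)).eval x = ev (RingHom.id O) 0 x f := by
      rw [ev_apply]; rfl
    rw [this]
    have h1 : ∀ t, ev (RingHom.id O) t x f = (f.eval (C x)).eval t := by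
      intro t
      have := map_ev (evalRingHom t) (C : O →+* O[X]) X (C x) f
      simp only [coe_evalRingHom, eval_X, eval_C] at this
      rw [show (evalRingHom t).comp C = RingHom.id O by ext; simp] at this
      rw [← this]
      congr 1
      rw [ev, coe_eval₂RingHom]
      rw [show (eval₂RingHom (C : O →+* O[X]) X) = RingHom.id _ by ext <;> simp, eval₂_id]
    rw [h1, h1]
    exact (by simpa using ht : p ∣ t - 0).trans (sub_dvd_eval_sub t 0 _)
  have evP : ∀ q : O[X][X], aeval (mk (C x₀)) (q.map mk) = mk (q.eval (C x₀)) := by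
    intro q
    rw [coe_aeval_eq_eval, eval_map, eval₂_hom]
  have ev0 : ∀ q : O[X][X], (q.eval (C x₀)).eval 0 = (q.map (evalRingHom 0)).eval x₀ := by
    intro q
    rw [← coe_evalRingHom 0, ← eval_map_apply]; simp
  have f0 : p ∣ (f.map (evalRingHom 0)).eval x₀ := by
    have := evdiff t₀ x₀ ht₀
    rwa [h₀, zero_sub, dvd_neg] at this
  have hnil : IsNilpotent (aeval (mk (C x₀)) P) := by
    rw [evP, key0, ev0]
    exact nilmul _ f0
  have hunit : IsUnit (aeval (mk (C x₀)) (derivative P)) := by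
    rw [derivative_map, evP]
    obtain ⟨u, v, huv⟩ := hp
    have e := congrArg (eval x₀) hδ
    simp only [eval_add, eval_mul, eval_C] at e
    set D := (derivative f).eval (C x₀)
    have eD : D.eval 0 = (derivative (f.map (evalRingHom 0))).eval x₀ := by
      rw [ev0, derivative_map]
    have hn : IsNilpotent (mk (C (v * b.eval x₀) * D - 1)) := by
      rw [key0]
      refine nilmul _ ?_
      simp only [eval_sub, eval_mul, eval_C, eval_one, eD]
      have : v * b.eval x₀ * (derivative (f.map (evalRingHom 0))).eval x₀ - 1 =
          - (u * p + v * (a.eval x₀ * (f.map (evalRingHom 0)).eval x₀)) := by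
        linear_combination v * e + huv
      rw [this, dvd_neg]
      exact dvd_add (Dvd.intro_left _ rfl) ((f0.mul_left _).mul_left _)
    have : IsUnit (mk (C (v * b.eval x₀) * D)) := by
      have := hn.isUnit_add_one
      simpa using this
    rw [map_mul] at this
    exact isUnit_of_mul_isUnit_right this
  obtain ⟨r, ⟨hr1, hr2⟩, -⟩ := existsUnique_nilpotent_sub_and_aeval_eq_zero hnil hunit
  obtain ⟨η, rfl⟩ := Ideal.Quotient.mk_surjective r
  refine ⟨η, fun t x ht hx hxx => ?_⟩
  set J : Ideal O := Ideal.span {p ^ E}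
  have hpJ : (Ideal.Quotient.mk J p) ^ E = 0 := by
    rw [← map_pow]; exact Ideal.Quotient.eq_zero_iff_mem.2 (Ideal.subset_span rfl)
  have nilJ : ∀ c, p ∣ c → (Ideal.Quotient.mk J c) ^ E = 0 := by
    rintro c ⟨d, rfl⟩
    rw [map_mul, mul_pow, hpJ, zero_mul]
  let ψ : A →+* O ⧸ J := Ideal.Quotient.lift I ((Ideal.Quotient.mk J).comp (evalRingHom t)) (by
    intro q hq
    refine Submodule.span_induction (p := fun q _ => ((Ideal.Quotient.mk J).comp (evalRingHom t)) q = 0)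
      ?_ (map_zero _) (fun _ _ _ _ h1 h2 => by rw [map_add, h1, h2, add_zero])
      (fun c _ _ h => by rw [smul_eq_mul, map_mul, h, mul_zero]) hq
    rintro q (rfl | rfl)
    · simp [hpJ]
    · simpa using nilJ t ht)
  have hψ : ∀ q, ψ (mk q) = Ideal.Quotient.mk J (q.eval t) := fun q => rfl
  have hPψ : ∀ z, aeval (ψ z) (P.map ψ) = ψ (aeval z P) := by
    intro z
    rw [coe_aeval_eq_eval, coe_aeval_eq_eval, eval_map_apply]
  have h1 : IsNilpotent (aeval (ψ (mk (C x₀))) (P.map ψ)) := by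
    rw [hPψ]; exact hnil.map ψ
  have h2 : IsUnit (aeval (ψ (mk (C x₀))) (derivative (P.map ψ))) := by
    have : aeval (ψ (mk (C x₀))) (derivative (P.map ψ)) = ψ (aeval (mk (C x₀)) (derivative P)) := by
      rw [coe_aeval_eq_eval, coe_aeval_eq_eval, derivative_map, eval_map_apply]
    rw [this]; exact hunit.map ψ
  have hu := (existsUnique_nilpotent_sub_and_aeval_eq_zero h1 h2).unique
    (y₁ := Ideal.Quotient.mk J x) (y₂ := ψ (mk η))
    ⟨?_, ?_⟩ ⟨?_, ?_⟩
  · rw [hψ, Ideal.Quotient.eq, Ideal.mem_span_singleton] at hu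
    exact hu
  · refine ⟨E, ?_⟩
    rw [hψ, eval_C, ← map_sub]
    refine nilJ _ ?_
    rw [← neg_sub, dvd_neg]; exact hxx
  · have : P.map ψ = f.map ((Ideal.Quotient.mk J).comp (evalRingHom t)) := by
      rw [map_map]; rfl
    rw [this, coe_aeval_eq_eval, ← map_map, eval_map_apply]
    have h3 : eval₂RingHom (RingHom.id O) t = evalRingHom t := by ext <;> simp
    rw [ev_apply, h3] at hx
    rw [hx, map_zero]
  · rw [← map_sub]; exact hr1.map ψ
  · rw [hPψ, hr2, map_zero]

theorem exponent_sum_div (D n : ℕ) : 2 * ∑ l ∈ Finset.range (n * D), l / D = D * n * (n - 1) := by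
  rcases Nat.eq_zero_or_pos D with rfl | hD
  · simp
  induction n with
  | zero => simp
  | succ n ih =>
    have : ∑ x ∈ Finset.range D, (n * D + x) / D = D * n := by
      rw [Finset.sum_congr rfl (g := fun _ => n)]
      · simp
      · intro x hx
        rw [mul_comm, Nat.mul_add_div hD, Nat.div_eq_of_lt (Finset.mem_range.1 hx), add_zero]
    rw [add_mul, one_mul, Finset.sum_range_add, mul_add, ih, this]
    cases n with
    | zero => simp
    | succ n => simp; ring

theorem exponent_bound (D n κ : ℕ) (hD : 2 ≤ D) (hn : n = 2 * κ + 3) :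
    n * D * (κ * (D - 1) + 1) + ∑ l ∈ Finset.range (n * D), l / D ≤
      ∑ l ∈ Finset.range (n * D), l := by
  obtain ⟨d, rfl⟩ : ∃ d, D = d + 2 := ⟨D - 2, by omega⟩
  have h1 := exponent_sum_div (d + 2) n
  have h2 : ∑ l ∈ Finset.range (n * (d + 2)), ((d + 2) * (l / (d + 2))) ≤
      ∑ l ∈ Finset.range (n * (d + 2)), l := Finset.sum_le_sum fun l _ => Nat.mul_div_le l _
  rw [← Finset.mul_sum] at h2
  refine le_trans ?_ h2
  set s := ∑ l ∈ Finset.range (n * (d + 2)), l / (d + 2)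
  have h3 : s = (d + 2) * n * (κ + 1) := by
    have : n - 1 = 2 * (κ + 1) := by omega
    rw [this] at h1
    linarith
  have h4 : d + 2 - 1 = d + 1 := rfl
  rw [h4]
  have h5 : n * (d + 2) * (κ * (d + 1) + 1) ≤ (d + 1) * s := by
    rw [h3]
    have : κ * (d + 1) + 1 ≤ (d + 1) * (κ + 1) := by nlinarith
    calc _ ≤ n * (d + 2) * ((d + 1) * (κ + 1)) := Nat.mul_le_mul_left _ this
      _ = _ := by ring
  nlinarith

theorem pow_dvd_det_arc {O : Type*} [CommRing O] [IsDomain O] (D n κ : ℕ) (hD : 2 ≤ D)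
    (hn : n = 2 * κ + 3) (π : O) (hπ : π ≠ 0) (η : O[X]) (i x : Fin (n * D) → O)
    (hx : ∀ r, π ^ (∑ l ∈ Finset.range (n * D), l) ∣ x r - η.eval (i r * π)) :
    π ^ (n * D * (κ * (D - 1) + 1)) ∣
      (Matrix.of fun r l : Fin (n * D) => i r ^ ((l : ℕ) / D) * x r ^ ((l : ℕ) % D)).det := by
  set e := ∑ l ∈ Finset.range (n * D), l with he
  set Δ := (Matrix.of fun r l : Fin (n * D) => i r ^ ((l : ℕ) / D) * x r ^ ((l : ℕ) % D)).det with hΔ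
  set s := ∑ l ∈ Finset.range (n * D), l / D with hs
  have h1 : (Matrix.of fun r l : Fin (n * D) => (i r * π) ^ ((l : ℕ) / D) * x r ^ ((l : ℕ) % D)).det
      = π ^ s * Δ := by
    rw [hΔ, hs, ← Finset.prod_pow_eq_pow_sum, Finset.prod_range, ← Matrix.det_mul_row]
    congr 1
    ext r l
    simp only [Matrix.of_apply]
    ring
  have h2 : π ^ e ∣ (Matrix.of fun r l : Fin (n * D) =>
      (i r * π) ^ ((l : ℕ) / D) * x r ^ ((l : ℕ) % D)).det := by
    have h3 := pow_dvd_det_eval (M := n * D)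
      (fun l => (X : O[X]) ^ ((l : ℕ) / D) * η ^ ((l : ℕ) % D)) (fun r => i r * π) π
      (fun r => Dvd.intro_left _ rfl)
    rw [← Finset.sum_range (fun l => l), ← he] at h3
    rw [← Ideal.mem_span_singleton, ← Ideal.Quotient.eq_zero_iff_mem] at h3 ⊢
    rw [← h3, RingHom.map_det, RingHom.map_det]
    congr 1
    ext r l
    simp only [RingHom.mapMatrix_apply, Matrix.map_apply, Matrix.of_apply, map_mul, map_pow,
      eval_mul, eval_pow, eval_X]
    have : Ideal.Quotient.mk (Ideal.span {π ^ e}) (x r) =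
        Ideal.Quotient.mk (Ideal.span {π ^ e}) (η.eval (i r * π)) := by
      rw [Ideal.Quotient.eq, Ideal.mem_span_singleton]; exact hx r
    rw [this]
  rw [h1] at h2
  have h3 := exponent_bound D n κ hD hn
  rw [← he, ← hs, add_comm] at h3
  have h4 := (pow_dvd_pow π h3).trans h2
  rw [pow_add] at h4
  exact (mul_dvd_mul_iff_left (pow_ne_zero _ hπ)).1 h4

theorem exists_relation_of_det_eq_zero {K : Type*} [Field K] {M : ℕ} (S : Set (Fin M → K))
    (hS : ∀ v : Fin M → Fin M → K, (∀ r, v r ∈ S) → (Matrix.of v).det = 0) :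
    ∃ c : Fin M → K, c ≠ 0 ∧ ∀ v ∈ S, ∑ l, c l * v l = 0 := by
  have hlt : Submodule.span K S < ⊤ := by
    refine lt_top_iff_ne_top.2 fun htop => ?_
    obtain ⟨b, hbS, hb, hli⟩ := exists_linearIndependent K S
    rw [htop] at hb
    let B : Module.Basis b K (Fin M → K) := Module.Basis.mk hli (by simp [hb])
    have : Fintype b := FiniteDimensional.fintypeBasisIndex B
    have hc : Fintype.card b = M := by
      rw [← Module.finrank_eq_card_basis B]; simp
    let eq : Fin M ≃ b := (Fintype.equivFinOfCardEq hc).symm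
    have h := hS (fun r => (eq r : Fin M → K)) (fun r => hbS (eq r).2)
    have hli' : LinearIndependent K (fun r : Fin M => (eq r : Fin M → K)) :=
      hli.comp _ eq.injective
    have hu : IsUnit (Matrix.of fun r : Fin M => (eq r : Fin M → K)) :=
      Matrix.linearIndependent_rows_iff_isUnit.1 hli'
    rw [Matrix.isUnit_iff_isUnit_det, h] at hu
    exact not_isUnit_zero hu
  obtain ⟨φ, hφ, hle⟩ := Submodule.exists_le_ker_of_lt_top _ hlt
  refine ⟨fun l => φ (Pi.single l 1), fun h => hφ ?_, fun v hv => ?_⟩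
  · refine (Pi.basisFun K (Fin M)).ext fun l => ?_
    simpa using congrFun h l
  · have h1 : φ v = 0 := hle (Submodule.subset_span hv)
    rw [← h1]
    conv_rhs => rw [pi_eq_sum_univ' v, map_sum]
    refine Finset.sum_congr rfl fun l _ => ?_
    rw [map_smul, smul_eq_mul, mul_comm]

theorem natDegree_det_le {R : Type*} [CommRing R] {n B : ℕ} (A : Matrix (Fin n) (Fin n) R[X])
    (hA : ∀ i j, (A i j).natDegree ≤ B) : A.det.natDegree ≤ n * B := by
  rw [Matrix.det_apply]
  refine natDegree_sum_le_of_forall_le _ _ fun σ _ => ?_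
  refine (natDegree_smul_le _ _).trans ((natDegree_prod_le _ _).trans ?_)
  refine (Finset.sum_le_sum fun i _ => hA _ _).trans ?_
  simp

theorem natDegree_resultant_le {R : Type*} [CommRing R] (f g : R[X][X]) (m n B : ℕ)
    (hf : ∀ j, (f.coeff j).natDegree ≤ B) (hg : ∀ j, (g.coeff j).natDegree ≤ B) :
    (resultant f g m n).natDegree ≤ (m + n) * B := by
  refine natDegree_det_le _ fun i j => ?_
  induction j using Fin.addCases <;> simp only [sylvester, Matrix.of_apply, Fin.addCases_left,
    Fin.addCases_right] <;> split_ifs <;> simp [hf, hg]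

theorem card_common_roots_le {K : Type*} [Field K] (f R : K[X][X]) (hf : f.Monic)
    (hirr : Irreducible f) (hR : R ≠ 0) (hdeg : R.natDegree < f.natDegree) (B : ℕ)
    (hfB : ∀ j, (f.coeff j).natDegree ≤ B) (hRB : ∀ j, (R.coeff j).natDegree ≤ B) (S : Finset K)
    (hS : ∀ t ∈ S, ∃ x, ev (RingHom.id K) t x f = 0 ∧ ev (RingHom.id K) t x R = 0) :
    S.card ≤ 2 * f.natDegree * B := by
  have hirr' := (hf.irreducible_iff_irreducible_map_fraction_map (K := FractionRing K[X])).1 hirr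
  have hinj := IsFractionRing.injective K[X] (FractionRing K[X])
  have hcop : IsCoprime (f.map (algebraMap K[X] (FractionRing K[X])))
      (R.map (algebraMap K[X] (FractionRing K[X]))) := by
    refine (EuclideanDomain.dvd_or_coprime _ _ hirr').resolve_left fun h => ?_
    have h2 := natDegree_le_of_dvd h ((Polynomial.map_ne_zero_iff hinj).2 hR)
    rw [natDegree_map_eq_of_injective hinj, natDegree_map_eq_of_injective hinj] at h2
    omega
  have hres : resultant f R ≠ 0 := by
    intro h0
    have := resultant_ne_zero _ _ hcop
    rw [natDegree_map_eq_of_injective hinj, natDegree_map_eq_of_injective hinj,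
      resultant_map_map, h0, map_zero] at this
    exact this rfl
  obtain ⟨p, q, -, -, hpq⟩ := exists_mul_add_mul_eq_C_resultant f R le_rfl le_rfl
    (Or.inl (by omega))
  have h1 : S.card ≤ (resultant f R).natDegree := by
    refine card_le_degree_of_subset_roots fun t ht => ?_
    obtain ⟨x, h1, h2⟩ := hS t ht
    have := congrArg (ev (RingHom.id K) t x) hpq
    rw [map_add, map_mul, map_mul, h1, h2, ev_C] at this
    rw [mem_roots hres, IsRoot, eval, ← this]
    ring
  refine h1.trans ((natDegree_resultant_le f R _ _ B hfB hRB).trans ?_)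
  exact Nat.mul_le_mul_right _ (by omega)

theorem eq_zero_of_dvd_of_norm_lt {K : Type*} [Field K] [NumberField K] (Δ : NumberField.RingOfIntegers K) (m : ℕ)
    (hm : (m : NumberField.RingOfIntegers K) ∣ Δ) (h : ∀ σ : K →+* ℂ, ‖σ Δ‖ < m) : Δ = 0 := by
  obtain ⟨z, rfl⟩ := hm
  by_contra h0
  obtain ⟨σ, hσ⟩ := NumberField.exists_conjugate_one_le_norm (right_ne_zero_of_mul h0)
  have := h σ
  simp only [map_mul, map_natCast, norm_mul, Complex.norm_natCast] at this
  nlinarith [(Nat.cast_nonneg m : (0 : ℝ) ≤ m)]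

theorem exists_root_norm_le {K : Type*} [Field K] (f : K[X][X]) (hf : f.Monic) (σ : K →+* ℂ) (κ : ℕ)
    (hκ : ∀ j, (f.coeff j).natDegree ≤ κ) :
    ∃ c : ℝ, 1 ≤ c ∧ ∀ (t : ℕ) (T : ℝ) (x : K), t ≤ T → 1 ≤ T → ev (RingHom.id K) (t : K) x f = 0 →
      ‖σ x‖ ≤ c * T ^ κ := by
  let c1 : ℝ := ∑ j ∈ Finset.range f.natDegree, ∑ u ∈ Finset.range (κ + 1), ‖σ ((f.coeff j).coeff u)‖
  have hc1 : 0 ≤ c1 := Finset.sum_nonneg fun _ _ => Finset.sum_nonneg fun _ _ => norm_nonneg _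
  refine ⟨c1 + 1, by linarith, fun t T x ht hT hx => ?_⟩
  have hT' : 1 ≤ T ^ κ := one_le_pow₀ hT
  set F : ℂ[X] := f.map (eval₂RingHom σ (t : ℂ)) with hF
  have hFm : F.Monic := hf.map _
  have hroot : F.IsRoot (σ x) := by
    have := congrArg σ hx
    rw [map_ev, map_zero, ev_apply] at this
    simpa using this
  have h1 := hroot.norm_lt_cauchyBound hFm.ne_zero
  have h2 : (F.cauchyBound : ℝ) ≤ c1 * T ^ κ + 1 := by
    have h3 : ∀ j ∈ Finset.range F.natDegree, ‖F.coeff j‖ ≤ c1 * T ^ κ := by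
      intro j hj
      rw [hF, hf.natDegree_map] at hj
      have e : F.coeff j = ∑ u ∈ Finset.range (κ + 1), σ ((f.coeff j).coeff u) * (t : ℂ) ^ u := by
        rw [hF, coeff_map, coe_eval₂RingHom, eval₂_eq_sum_range' _ (Nat.lt_succ_of_le (hκ j))]
      rw [e]
      calc _ ≤ ∑ u ∈ Finset.range (κ + 1), ‖σ ((f.coeff j).coeff u)‖ * T ^ κ := by
            refine norm_sum_le_of_le _ fun u hu => ?_
            rw [norm_mul, norm_pow, Complex.norm_natCast]
            refine mul_le_mul_of_nonneg_left ?_ (norm_nonneg _)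
            refine (pow_le_pow_left₀ (Nat.cast_nonneg _) ht u).trans (pow_le_pow_right₀ hT ?_)
            have := Finset.mem_range.1 hu; omega
        _ ≤ _ := by
            rw [← Finset.sum_mul]
            refine mul_le_mul_of_nonneg_right ?_ (by positivity)
            exact Finset.single_le_sum (f := fun j => ∑ u ∈ Finset.range (κ + 1), ‖σ ((f.coeff j).coeff u)‖)
              (fun _ _ => Finset.sum_nonneg fun _ _ => norm_nonneg _) hj
    have h4 : (Finset.range F.natDegree).sup (fun x => ‖F.coeff x‖₊) ≤ Real.toNNReal (c1 * T ^ κ) := by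
      refine Finset.sup_le fun j hj => ?_
      rw [← norm_toNNReal]
      exact Real.toNNReal_le_toNNReal (h3 j hj)
    rw [cauchyBound, hFm.leadingCoeff]
    simp only [nnnorm_one, div_one, NNReal.coe_add, NNReal.coe_one]
    have := NNReal.coe_le_coe.2 h4
    rw [Real.coe_toNNReal _ (by positivity)] at this
    linarith
  have h5 : ‖σ x‖ ≤ F.cauchyBound := by exact_mod_cast h1.le
  nlinarith

open NumberField in
/-- Points of an affine curve with parameters in an arithmetic progression of step a high power of
`p` and with fixed reduction modulo `p` satisfy a relation of small degree. -/
theorem exists_relation_of_class {K : Type*} [Field K] [NumberField K] (f : (𝓞 K)[X][X]) (hf : f.Monic)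
    (hD : 2 ≤ f.natDegree) (κ : ℕ) (hκ : ∀ j, (f.coeff j).natDegree ≤ κ)
    (a b : (𝓞 K)[X]) (δ p : ℕ) (hp : p.Prime) (hδp : ¬ p ∣ δ)
    (hδ : a * f.map (evalRingHom 0) + b * derivative (f.map (evalRingHom 0)) = C (δ : 𝓞 K))
    (N : ℕ) : ∀ᶠ k : ℕ in Filter.atTop, ∀ x₀ : 𝓞 K,
      ∃ c : Fin ((2 * κ + 3) * f.natDegree) → K, c ≠ 0 ∧
        ∀ i < N, ∀ x : 𝓞 K, (p : 𝓞 K) ∣ x - x₀ → ev (RingHom.id (𝓞 K)) ((i : 𝓞 K) * p ^ k) x f = 0 →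
          ∑ l, c l * ((i : K) ^ ((l : ℕ) / f.natDegree) * (x : K) ^ ((l : ℕ) % f.natDegree)) = 0 := by
  set D := f.natDegree
  set n := 2 * κ + 3 with hn
  set M := n * D
  have hM : 0 < M := Nat.mul_pos (by omega) (by omega)
  have hinjK : Function.Injective (algebraMap (𝓞 K) K) := IsFractionRing.injective _ _
  -- size constants
  have hsize : ∃ c : ℝ, 1 ≤ c ∧ ∀ (σ : K →+* ℂ) (t : ℕ) (T : ℝ) (x : 𝓞 K), t ≤ T → 1 ≤ T →
      ev (RingHom.id _) (t : 𝓞 K) x f = 0 → ‖σ x‖ ≤ c * T ^ κ := by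
    choose c hc1 hc using fun σ : K →+* ℂ => exists_root_norm_le
      (f.map (mapRingHom (algebraMap (𝓞 K) K))) (hf.map _) σ κ
      (fun j => by rw [coeff_map]; exact natDegree_map_le.trans (hκ j))
    refine ⟨1 + ∑ σ, c σ, ?_, fun σ t T x ht hT hx => ?_⟩
    · have : 0 ≤ ∑ σ, c σ := Finset.sum_nonneg fun σ _ => by linarith [hc1 σ]
      linarith
    · refine (hc σ t T x ht hT ?_).trans ?_
      · have := congrArg (algebraMap (𝓞 K) K) hx
        rw [map_ev, map_zero] at this
        rw [ev_map]
        simpa using this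
      · refine mul_le_mul_of_nonneg_right ?_ (by positivity)
        have := Finset.single_le_sum (f := c) (fun σ _ => by linarith [hc1 σ]) (Finset.mem_univ σ)
        linarith
  obtain ⟨c, hc1, hc⟩ := hsize
  set c2 : ℝ := (M.factorial : ℝ) * ((N + 1 : ℝ) ^ n * (c * (N + 1 : ℝ) ^ κ) ^ (D - 1)) ^ M with hc2
  have hbig : ∀ᶠ k : ℕ in Filter.atTop, c2 < (p : ℝ) ^ k :=
    (tendsto_pow_atTop_atTop_of_one_lt (by exact_mod_cast hp.one_lt)).eventually_gt_atTop c2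
  filter_upwards [hbig, Filter.eventually_ge_atTop 1] with k hk hk1 x₀
  have hπ0 : (p : 𝓞 K) ^ k ≠ 0 := pow_ne_zero _ (by exact_mod_cast hp.ne_zero)
  have hcop : IsCoprime (p : 𝓞 K) (δ : 𝓞 K) := by
    have := (Nat.isCoprime_iff_coprime.2 ((Nat.Prime.coprime_iff_not_dvd hp).2 hδp)).map (Int.castRingHom (𝓞 K))
    simpa using this
  have hppos : (1 : ℝ) ≤ (p : ℝ) ^ k := one_le_pow₀ (by exact_mod_cast hp.one_le)
  let S : Set (ℕ × 𝓞 K) := {z | z.1 < N ∧ (p : 𝓞 K) ∣ z.2 - x₀ ∧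
    ev (RingHom.id (𝓞 K)) ((z.1 : 𝓞 K) * p ^ k) z.2 f = 0}
  -- the determinants vanish
  have hdet : ∀ z : Fin M → ℕ × 𝓞 K, (∀ r, z r ∈ S) → (Matrix.of fun r l : Fin M =>
      ((z r).1 : 𝓞 K) ^ ((l : ℕ) / D) * (z r).2 ^ ((l : ℕ) % D)).det = 0 := by
    intro z hz
    set e := ∑ l ∈ Finset.range (n * D), l with he
    have hdvd : ∃ η : (𝓞 K)[X], ∀ r, ((p : 𝓞 K) ^ k) ^ e ∣ (z r).2 - η.eval (((z r).1 : 𝓞 K) * (p : 𝓞 K) ^ k) := by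
      obtain ⟨h1, h2, h3⟩ := hz ⟨0, hM⟩
      obtain ⟨η, hη⟩ := exists_approx_root f a b δ p hδ hcop (k * e) _ (z ⟨0, hM⟩).2
        ((dvd_pow_self (p : 𝓞 K) (by omega : k ≠ 0)).mul_left _) h3
      refine ⟨η, fun r => ?_⟩
      rw [← pow_mul]
      refine hη _ _ ((dvd_pow_self (p : 𝓞 K) (by omega : k ≠ 0)).mul_left _) (hz r).2.2 ?_
      have := dvd_sub (hz r).2.1 h2
      simpa using this
    obtain ⟨η, hη⟩ := hdvd
    have h1 := pow_dvd_det_arc D n κ hD hn ((p : 𝓞 K) ^ k) hπ0 η (fun r => ((z r).1 : 𝓞 K))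
      (fun r => (z r).2) hη
    refine eq_zero_of_dvd_of_norm_lt _ ((p ^ k) ^ (M * (κ * (D - 1) + 1))) (by exact_mod_cast h1) ?_
    intro σ
    have hent : ∀ r l : Fin M, ‖σ (((z r).1 : K) ^ ((l : ℕ) / D) * ((z r).2 : K) ^ ((l : ℕ) % D))‖ ≤
        (N + 1 : ℝ) ^ n * (c * ((N + 1 : ℝ) * p ^ k) ^ κ) ^ (D - 1) := by
      intro r l
      rw [map_mul, map_pow, map_pow, norm_mul, norm_pow, norm_pow, map_natCast, Complex.norm_natCast]
      have hl1 : (l : ℕ) / D ≤ n := (Nat.div_lt_of_lt_mul (l.2.trans_eq (mul_comm _ _))).le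
      have hl2 : (l : ℕ) % D ≤ D - 1 := by have := Nat.mod_lt (l : ℕ) (by omega : D > 0); omega
      have hT : (1 : ℝ) ≤ (N + 1 : ℝ) * p ^ k := by
        have : (0 : ℝ) ≤ N := Nat.cast_nonneg _
        nlinarith
      have hzN : ((z r).1 : ℝ) ≤ N + 1 := by
        have : ((z r).1 : ℝ) ≤ N := by exact_mod_cast (hz r).1.le
        linarith
      have h3 : ‖σ ((z r).2 : K)‖ ≤ c * ((N + 1 : ℝ) * p ^ k) ^ κ := by
        refine hc σ ((z r).1 * p ^ k) _ _ ?_ hT ?_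
        · push_cast
          exact mul_le_mul_of_nonneg_right hzN (by positivity)
        · have := (hz r).2.2
          push_cast
          exact this
      refine mul_le_mul ?_ ?_ (by positivity) (by positivity)
      · refine (pow_le_pow_left₀ (by positivity) hzN _).trans (pow_le_pow_right₀ ?_ hl1)
        have : (0 : ℝ) ≤ N := Nat.cast_nonneg _
        linarith
      · refine (pow_le_pow_left₀ (by positivity) h3 _).trans (pow_le_pow_right₀ ?_ hl2)
        exact one_le_mul_of_one_le_of_one_le hc1 (one_le_pow₀ hT)
    have h2 := Matrix.det_le (abv := (AbsoluteValue.comp (NormedField.toAbsoluteValue ℂ) σ.injective)) hent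
    have h3 : (algebraMap (𝓞 K) K) (Matrix.of fun r l : Fin M =>
      ((z r).1 : 𝓞 K) ^ ((l : ℕ) / D) * (z r).2 ^ ((l : ℕ) % D)).det = (Matrix.of fun r l : Fin M =>
        ((z r).1 : K) ^ ((l : ℕ) / D) * ((z r).2 : K) ^ ((l : ℕ) % D)).det := by
      rw [RingHom.map_det]; congr 1
    change ‖σ _‖ ≤ _ at h2
    rw [Fintype.card_fin] at h2
    have h4 : ‖σ ((Matrix.of fun r l : Fin M =>
      ((z r).1 : 𝓞 K) ^ ((l : ℕ) / D) * (z r).2 ^ ((l : ℕ) % D)).det : K)‖ ≤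
        c2 * ((p : ℝ) ^ k) ^ (M * (κ * (D - 1))) := by
      rw [show ((Matrix.of fun r l : Fin M =>
        ((z r).1 : 𝓞 K) ^ ((l : ℕ) / D) * (z r).2 ^ ((l : ℕ) % D)).det : K) = _ from h3]
      refine h2.trans (le_of_eq ?_)
      rw [hc2, nsmul_eq_mul]
      simp only [mul_pow, ← pow_mul]
      ring
    refine h4.trans_lt ?_
    push_cast
    rw [mul_add, mul_one, pow_add, mul_comm]
    refine mul_lt_mul_of_pos_left ?_ (by positivity)
    exact hk.trans_le (le_self_pow₀ hppos hM.ne')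
  obtain ⟨c', hc'0, hc'⟩ := exists_relation_of_det_eq_zero (K := K) (M := M)
    ((fun z : ℕ × 𝓞 K => fun l : Fin M => ((z.1 : K) ^ ((l : ℕ) / D) * (z.2 : K) ^ ((l : ℕ) % D))) '' S) (by
      intro v hv
      choose z hz hzv using hv
      have := congrArg (algebraMap (𝓞 K) K) (hdet z hz)
      rw [RingHom.map_det, map_zero] at this
      rw [← this]
      congr 1
      ext r l
      simp [← hzv])
  exact ⟨c', hc'0, fun i hi x hx hfx => hc' _ ⟨(i, x), ⟨hi, hx, hfx⟩, rfl⟩⟩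

open NumberField in
theorem card_parameters_with_root_le {K : Type*} [Field K] [NumberField K] (f : (𝓞 K)[X][X]) (hf : f.Monic)
    (hirr : Irreducible (f.map (mapRingHom (algebraMap (𝓞 K) K))))
    (hD : 2 ≤ f.natDegree)
    (a b : (𝓞 K)[X]) (δ p : ℕ) (hp : p.Prime) (hδp : ¬ p ∣ δ)
    (hδ : a * f.map (evalRingHom 0) + b * derivative (f.map (evalRingHom 0)) = C (δ : 𝓞 K)) :
    ∃ B : ℕ, ∀ N : ℕ, ∀ᶠ k : ℕ in Filter.atTop,
      {i | i < N ∧ ∃ x : 𝓞 K, ev (RingHom.id (𝓞 K)) ((i : 𝓞 K) * p ^ k) x f = 0}.ncard ≤ B := by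
  classical
  obtain ⟨κ, hκ⟩ : ∃ κ, ∀ j, (f.coeff j).natDegree ≤ κ := by
    refine ⟨∑ j ∈ f.support, (f.coeff j).natDegree, fun j => ?_⟩
    by_cases hj : j ∈ f.support
    · exact Finset.single_le_sum (f := fun j => (f.coeff j).natDegree) (fun _ _ => Nat.zero_le _) hj
    · simp [notMem_support_iff.1 hj]
  set D := f.natDegree with hDdef
  have hpos : 0 < D := by omega
  have hpI : Ideal.span {(p : 𝓞 K)} ≠ ⊥ := by
    simp [hp.ne_zero]
  have hfin : Finite (𝓞 K ⧸ Ideal.span {(p : 𝓞 K)}) := Ideal.finiteQuotientOfFreeOfNeBot _ hpI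
  have := Fintype.ofFinite (𝓞 K ⧸ Ideal.span {(p : 𝓞 K)})
  set F := f.map (mapRingHom (algebraMap (𝓞 K) K)) with hF
  have hFm : F.Monic := hf.map _
  have hFD : F.natDegree = D := hf.natDegree_map _
  set n := 2 * κ + 3 with hn
  refine ⟨(2 * D * n) * Fintype.card (𝓞 K ⧸ Ideal.span {(p : 𝓞 K)}), fun N => ?_⟩
  filter_upwards [exists_relation_of_class f hf hD κ hκ a b δ p hp hδp hδ N] with k hk
  have hπ0 : (p : K) ^ k ≠ 0 := pow_ne_zero _ (by exact_mod_cast hp.ne_zero)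
  set S : Finset ℕ := {i ∈ Finset.range N |
    ∃ x : 𝓞 K, ev (RingHom.id (𝓞 K)) ((i : 𝓞 K) * p ^ k) x f = 0}
  have hS : {i | i < N ∧ ∃ x : 𝓞 K, ev (RingHom.id (𝓞 K)) ((i : 𝓞 K) * p ^ k) x f = 0} = (S : Set ℕ) := by
    ext i; simp [S]
  rw [hS, Set.ncard_coe_finset]
  choose! x hx using fun i (hi : i ∈ S) => (Finset.mem_filter.1 hi).2
  refine (Finset.card_le_mul_card_image (f := fun i => Ideal.Quotient.mk (Ideal.span {(p : 𝓞 K)}) (x i)) S (2 * D * n)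
    fun y hy => ?_).trans (Nat.mul_le_mul_left _ (Finset.card_le_univ _))
  obtain ⟨i₀, hi₀, rfl⟩ := Finset.mem_image.1 hy
  obtain ⟨c, hc0, hc⟩ := hk (x i₀)
  let R : K[X][X] := ∑ l : Fin (n * D), monomial ((l : ℕ) % D) (monomial ((l : ℕ) / D) (c l * ((p : K) ^ k)⁻¹ ^ ((l : ℕ) / D)))
  have hRc : ∀ l : Fin (n * D), (R.coeff ((l : ℕ) % D)).coeff ((l : ℕ) / D) = c l * ((p : K) ^ k)⁻¹ ^ ((l : ℕ) / D) := by
    intro l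
    simp only [R, finsetSum_coeff]
    rw [Finset.sum_eq_single l]
    · simp
    · intro l' _ hl'
      rw [coeff_monomial]
      split_ifs with h
      · rw [coeff_monomial, if_neg]
        intro h'
        apply hl'
        ext
        rw [← Nat.div_add_mod (l : ℕ) D, ← Nat.div_add_mod (l' : ℕ) D, h, h']
      · simp
    · simp
  have hR0 : R ≠ 0 := by
    obtain ⟨l, hl⟩ := Function.ne_iff.1 hc0
    intro h
    have := hRc l
    rw [h] at this
    simp at this
    rcases this with h | ⟨h, -⟩
    · exact hl h
    · exact hp.ne_zero h.1
  have hRdeg : R.natDegree < D := by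
    refine lt_of_le_of_lt (natDegree_sum_le_of_forall_le (n := D - 1) _ _ fun l _ => ?_) (by omega)
    refine (natDegree_monomial_le _).trans ?_
    have := Nat.mod_lt (l : ℕ) hpos
    omega
  have hRB : ∀ j, (R.coeff j).natDegree ≤ n := by
    intro j
    simp only [R, finsetSum_coeff]
    refine natDegree_sum_le_of_forall_le _ _ fun l _ => ?_
    rw [coeff_monomial]
    split_ifs
    · refine (natDegree_monomial_le _).trans (Nat.div_lt_of_lt_mul (l.2.trans_eq (mul_comm _ _))).le
    · simp
  have hFB : ∀ j, (F.coeff j).natDegree ≤ n := fun j => by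
    rw [hF, coeff_map]; exact natDegree_map_le.trans ((hκ j).trans (by omega))
  have hinj : Function.Injective fun i : ℕ => (i : K) * (p : K) ^ k := fun i j h => by
    have := mul_right_cancel₀ hπ0 h
    exact_mod_cast this
  rw [← Finset.card_image_of_injective _ hinj]
  have := card_common_roots_le F R hFm hirr hR0 (by rw [hFD]; exact hRdeg) n hFB hRB
    (Finset.image (fun i : ℕ => (i : K) * (p : K) ^ k)
      {i ∈ S | Ideal.Quotient.mk (Ideal.span {(p : 𝓞 K)}) (x i) = Ideal.Quotient.mk (Ideal.span {(p : 𝓞 K)}) (x i₀)}) (by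
      intro t ht
      obtain ⟨i, hi, rfl⟩ := Finset.mem_image.1 ht
      obtain ⟨hiS, hi⟩ := Finset.mem_filter.1 hi
      refine ⟨(x i : K), ?_, ?_⟩
      · have := congrArg (algebraMap (𝓞 K) K) (hx i hiS)
        rw [map_ev, map_zero] at this
        rw [hF, ev_map]
        simpa using this
      · rw [Ideal.Quotient.eq, Ideal.mem_span_singleton] at hi
        rw [← hc i (Finset.mem_range.1 (Finset.mem_filter.1 hiS).1) (x i) hi (hx i hiS)]
        simp only [R, map_sum]
        refine Finset.sum_congr rfl fun l _ => ?_
        rw [← C_mul_X_pow_eq_monomial, map_mul, map_pow, ev_X, ev_C, ← C_mul_X_pow_eq_monomial]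
        simp only [eval₂_mul, eval₂_C, eval₂_X_pow, RingHom.id_apply, mul_pow, inv_pow, ← hDdef]
        field_simp [pow_ne_zero ((l : ℕ) / D) hπ0])
  rwa [hFD] at this

theorem exists_mul_add_mul_eq_C_ne_zero {K : Type*} [Field K] (f R : K[X][X]) (hf : f.Monic)
    (hirr : Irreducible f) (hR : R ≠ 0) (hdeg : R.natDegree < f.natDegree) :
    ∃ (p q : K[X][X]) (ρ : K[X]), ρ ≠ 0 ∧ f * p + R * q = C ρ := by
  have hirr' := (hf.irreducible_iff_irreducible_map_fraction_map (K := FractionRing K[X])).1 hirr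
  have hinj := IsFractionRing.injective K[X] (FractionRing K[X])
  have hcop : IsCoprime (f.map (algebraMap K[X] (FractionRing K[X])))
      (R.map (algebraMap K[X] (FractionRing K[X]))) := by
    refine (EuclideanDomain.dvd_or_coprime _ _ hirr').resolve_left fun h => ?_
    have h2 := natDegree_le_of_dvd h ((Polynomial.map_ne_zero_iff hinj).2 hR)
    rw [natDegree_map_eq_of_injective hinj, natDegree_map_eq_of_injective hinj] at h2
    omega
  obtain ⟨p, q, -, -, hpq⟩ := exists_mul_add_mul_eq_C_resultant f R le_rfl le_rfl
    (Or.inl (by omega))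
  refine ⟨p, q, _, fun h0 => ?_, hpq⟩
  have := resultant_ne_zero _ _ hcop
  rw [natDegree_map_eq_of_injective hinj, natDegree_map_eq_of_injective hinj,
    resultant_map_map, h0, map_zero] at this
  exact this rfl

theorem derivative_scaleRoots {K : Type*} [Field K] [CharZero K] (p : K[X]) (s : K) :
    derivative (p.scaleRoots s) = (derivative p).scaleRoots s := by
  ext j
  rw [coeff_derivative, coeff_scaleRoots, coeff_scaleRoots, coeff_derivative, natDegree_derivative]
  rw [Nat.sub_sub, add_comm 1 j]
  ring

theorem irreducible_scaleRoots {A : Type*} [CommRing A] [IsDomain A] {f : A[X]} (hf : f.Monic) (hirr : Irreducible f)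
    {s : A} (hs : IsUnit s) : Irreducible (f.scaleRoots s) := by
  obtain ⟨u, rfl⟩ := hs
  have hinv : ∀ g : A[X], (g.scaleRoots (u : A)).scaleRoots (↑u⁻¹ : A) = g := fun g => by
    rw [← scaleRoots_mul]; simp
  have hm : (f.scaleRoots (u : A)).Monic := (monic_scaleRoots_iff _).2 hf
  rw [hm.irreducible_iff_natDegree]
  rw [hf.irreducible_iff_natDegree] at hirr
  refine ⟨fun h => hirr.1 ?_, fun a b ha hb hab => ?_⟩
  · rw [← hinv f, h]; simp
  · have := hirr.2 (a.scaleRoots ↑u⁻¹) (b.scaleRoots ↑u⁻¹) ((monic_scaleRoots_iff _).2 ha)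
      ((monic_scaleRoots_iff _).2 hb) (by rw [← mul_scaleRoots_of_noZeroDivisors, hab, hinv])
    simpa using this

/-- A set of rationals is thin if it meets, in boundedly many points, most short arithmetic
progressions with step a high power of a large prime. -/
def Thin (B : Set ℚ) : Prop :=
  ∀ᶠ c : ℚ in Filter.cofinite, ∀ᶠ p : ℕ in Filter.atTop, p.Prime → ∃ m : ℕ, ∀ N : ℕ,
    ∀ᶠ k : ℕ in Filter.atTop, {i : ℕ | i < N ∧ c + i * (p : ℚ) ^ k ∈ B}.ncard ≤ m

theorem Thin.mono {B B' : Set ℚ} (h : Thin B') (hB : B ⊆ B') : Thin B := by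
  filter_upwards [h] with c hc
  filter_upwards [hc] with p hp hpp
  obtain ⟨m, hm⟩ := hp hpp
  refine ⟨m, fun N => ?_⟩
  filter_upwards [hm N] with k hk
  refine (Set.ncard_le_ncard ?_ ?_).trans hk
  · exact fun i hi => ⟨hi.1, hB hi.2⟩
  exact (Set.finite_lt_nat N).subset fun i hi => hi.1

theorem Thin.union {B B' : Set ℚ} (h : Thin B) (h' : Thin B') : Thin (B ∪ B') := by
  filter_upwards [h, h'] with c hc hc'
  filter_upwards [hc, hc'] with p hp hp' hpp
  obtain ⟨m, hm⟩ := hp hpp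
  obtain ⟨m', hm'⟩ := hp' hpp
  refine ⟨m + m', fun N => ?_⟩
  filter_upwards [hm N, hm' N] with k hk hk'
  refine (Set.ncard_le_ncard (t := {i : ℕ | i < N ∧ c + i * (p : ℚ) ^ k ∈ B} ∪
    {i : ℕ | i < N ∧ c + i * (p : ℚ) ^ k ∈ B'}) ?_ ?_).trans ((Set.ncard_union_le _ _).trans (add_le_add hk hk'))
  · rintro i ⟨hi, h | h⟩
    · exact Or.inl ⟨hi, h⟩
    · exact Or.inr ⟨hi, h⟩
  · exact (Set.finite_lt_nat N).subset (Set.union_subset (fun i hi => hi.1) fun i hi => hi.1)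

theorem thin_of_finite {B : Set ℚ} (hB : B.Finite) : Thin B := by
  refine Filter.Eventually.of_forall fun c => Filter.Eventually.of_forall fun p hp => ⟨B.ncard, fun N =>
    Filter.Eventually.of_forall fun k => ?_⟩
  refine Set.ncard_le_ncard_of_injOn (fun i : ℕ => c + i * (p : ℚ) ^ k) (fun i hi => hi.2) ?_ hB
  intro i _ j _ hij
  have h0 : (p : ℚ) ^ k ≠ 0 := pow_ne_zero _ (by exact_mod_cast hp.ne_zero)
  have := mul_right_cancel₀ h0 (add_left_cancel hij)
  exact_mod_cast this

theorem thin_biUnion {ι : Type*} {s : Set ι} (hs : s.Finite) {B : ι → Set ℚ} (h : ∀ i ∈ s, Thin (B i)) :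
    Thin (⋃ i ∈ s, B i) := by
  induction s, hs using Set.Finite.induction_on with
  | empty => simpa using thin_of_finite Set.finite_empty
  | insert _ _ ih =>
    rw [Set.biUnion_insert]
    exact (h _ (by simp)).union (ih fun i hi => h i (by simp [hi]))

theorem Thin.exists_notMem {B : Set ℚ} (h : Thin B) : ∃ t, t ∉ B ∧ ¬ IsIntegral ℤ t := by
  have hinf : {c : ℚ | ∃ n : ℤ, c = n + 1 / 2}.Infinite := by
    have : Function.Injective fun n : ℤ => (n : ℚ) + 1 / 2 := fun a b h => by simpa using h
    exact (Set.infinite_range_of_injective this).mono (by rintro _ ⟨n, rfl⟩; exact ⟨n, rfl⟩)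
  obtain ⟨c, ⟨n, rfl⟩, hc⟩ := (hinf.frequently_cofinite.and_eventually h).exists
  obtain ⟨p, hc, hp⟩ := ((hc.and_frequently (Nat.frequently_atTop_iff_infinite.2 Nat.infinite_setOfPred_prime))).exists
  obtain ⟨m, hm⟩ := hc hp
  obtain ⟨k, hk⟩ := (hm (m + 1)).exists
  have : ∃ i < m + 1, (n : ℚ) + 1 / 2 + i * (p : ℚ) ^ k ∉ B := by
    by_contra! hcon
    have : {i : ℕ | i < m + 1 ∧ (n : ℚ) + 1 / 2 + i * (p : ℚ) ^ k ∈ B} = (Finset.range (m + 1) : Set ℕ) := by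
      ext i
      simpa using fun h => hcon i h
    rw [this, Set.ncard_coe_finset, Finset.card_range] at hk
    omega
  obtain ⟨i, -, hi⟩ := this
  refine ⟨_, hi, fun hint => ?_⟩
  obtain ⟨z, hz⟩ := IsIntegrallyClosed.isIntegral_iff.1 hint
  have h2 : (2 * z : ℚ) = 2 * n + 1 + 2 * (i * p ^ k) := by
    have : (z : ℚ) = (n : ℚ) + 1 / 2 + i * (p : ℚ) ^ k := by simpa using hz
    rw [this]; ring
  have h3 : 2 * z = 2 * n + 1 + 2 * (i * p ^ k) := by exact_mod_cast h2
  omega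

open NumberField in
theorem thin_root {K : Type*} [Field K] [NumberField K] (f : K[X][X]) (hf : f.Monic) (hirr : Irreducible f)
    (hD : 2 ≤ f.natDegree) : Thin {t | ∃ x : K, ev (RingHom.id K) (t : K) x f = 0} := by
  classical
  obtain ⟨A, B, d, hd, hAB⟩ := exists_mul_add_mul_eq_C_ne_zero f (derivative f) hf hirr
    (by
      intro h
      have := congrArg natDegree h
      rw [natDegree_derivative] at this
      simp at this
      omega)
    (natDegree_derivative_lt (by omega))
  have hcof : ∀ᶠ c : ℚ in Filter.cofinite, d.eval (c : K) ≠ 0 := by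
    rw [Filter.eventually_cofinite]
    have : {x : K | d.eval x = 0}.Finite := by
      refine (d.roots.toFinset.finite_toSet).subset fun x hx => ?_
      simpa [hd] using hx
    simpa using this.preimage (f := fun c : ℚ => (c : K)) Rat.cast_injective.injOn
  filter_upwards [hcof] with c hc
  -- translate
  let φ : K[X] ≃ₐ[K] K[X] := algEquivAevalXAddC (c : K)
  set f1 : K[X][X] := f.map (φ : K[X] →+* K[X]) with hf1
  have hf1m : f1.Monic := hf.map _
  have hf1D : f1.natDegree = f.natDegree := hf.natDegree_map _
  have hf1irr : Irreducible f1 := by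
    have := (MulEquiv.irreducible_iff (Polynomial.mapEquiv (φ : K[X] ≃+* K[X]))).2 hirr
    exact this
  have hφ : ∀ t : K, (eval₂RingHom (RingHom.id K) t).comp (φ : K[X] →+* K[X]) =
      eval₂RingHom (RingHom.id K) (c + t) := by
    intro t
    ext
    · simp [φ]
    · simp [φ, add_comm]
  have hev1 : ∀ t x : K, ev (RingHom.id K) t x f1 = ev (RingHom.id K) (c + t) x f := by
    intro t x
    rw [ev_apply, ev_apply, hf1, map_map, hφ]
  -- rescale
  obtain ⟨⟨s, hs0⟩, hs⟩ := IsLocalization.exist_integer_multiples_of_finset (nonZeroDivisors (𝓞 K))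
    ((Finset.range f1.natDegree).biUnion fun j => (f1.coeff j).support.image (f1.coeff j).coeff)
  have hs0 : s ≠ 0 := nonZeroDivisors.ne_zero hs0
  have hsK : (s : K) ≠ 0 := by simpa using hs0
  set f2' : K[X][X] := f1.scaleRoots (C (s : K)) with hf2'
  have hunit : IsUnit (C (s : K)) := isUnit_C.2 hsK.isUnit
  have hf2m : f2'.Monic := (monic_scaleRoots_iff _).2 hf1m
  have hf2'irr : Irreducible f2' := irreducible_scaleRoots hf1m hf1irr hunit
  have hlift : f2' ∈ lifts (mapRingHom (algebraMap (𝓞 K) K)) := by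
    rw [lifts_iff_coeff_lifts]
    intro j
    suffices f2'.coeff j ∈ lifts (algebraMap (𝓞 K) K) by
      obtain ⟨q, hq⟩ := (mem_lifts _).1 this
      exact ⟨q, hq⟩
    rw [hf2', coeff_scaleRoots]
    rcases lt_trichotomy j f1.natDegree with hj | rfl | hj
    · obtain ⟨e, he⟩ : ∃ e, f1.natDegree - j = e + 1 := ⟨f1.natDegree - j - 1, by omega⟩
      rw [he, pow_succ', ← mul_assoc]
      refine Subsemiring.mul_mem _ ?_ (Subsemiring.pow_mem _ ((mem_lifts _).2 ⟨C s, by simp⟩) _)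
      rw [lifts_iff_coeff_lifts]
      intro u
      rw [coeff_mul_C]
      by_cases hu : u ∈ (f1.coeff j).support
      · obtain ⟨z, hz⟩ := hs ((f1.coeff j).coeff u) (Finset.mem_biUnion.2 ⟨j, Finset.mem_range.2 hj,
          Finset.mem_image_of_mem _ hu⟩)
        exact ⟨z, by rw [hz, Algebra.smul_def, mul_comm]⟩
      · exact ⟨0, by rw [notMem_support_iff.1 hu]; simp⟩
    · rw [Nat.sub_self, pow_zero, mul_one, hf1m.coeff_natDegree]
      exact Subsemiring.one_mem _
    · rw [coeff_eq_zero_of_natDegree_lt hj, zero_mul]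
      exact Subsemiring.zero_mem _
  obtain ⟨f2, hf2, hf2D, hf2m⟩ := lifts_and_natDegree_eq_and_monic hlift hf2m
  -- separability at zero
  have hsep : IsCoprime ((f2.map (evalRingHom 0)).map (algebraMap (𝓞 K) K))
      ((derivative (f2.map (evalRingHom 0))).map (algebraMap (𝓞 K) K)) := by
    set g : K[X] := f.map (evalRingHom (c : K)) with hg
    have hgm : g.Monic := hf.map _
    have e1 : (f2.map (evalRingHom 0)).map (algebraMap (𝓞 K) K) = g.scaleRoots (s : K) := by
      have h1 : (algebraMap (𝓞 K) K).comp (evalRingHom 0) =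
          (evalRingHom (0 : K)).comp (mapRingHom (algebraMap (𝓞 K) K)) := by
        ext <;> simp
      rw [map_map, h1, ← map_map, hf2, hf2', map_scaleRoots _ _ _ (by rw [hf1m.leadingCoeff]; simp)]
      congr 1
      · rw [hf1, map_map]
        have := hφ 0
        rw [add_zero] at this
        have e3 : ∀ t : K, eval₂RingHom (RingHom.id K) t = evalRingHom t := fun t => by ext <;> simp
        rw [e3, e3] at this
        rw [this]
      · simp
    have hcop : IsCoprime g (derivative g) := by
      have h1 := congrArg (Polynomial.map (evalRingHom (c : K))) hAB
      rw [Polynomial.map_add, Polynomial.map_mul, Polynomial.map_mul, ← derivative_map, map_C] at h1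
      refine ⟨C (d.eval (c : K))⁻¹ * A.map (evalRingHom (c : K)), C (d.eval (c : K))⁻¹ * B.map (evalRingHom (c : K)), ?_⟩
      have h2 : C (d.eval (c : K))⁻¹ * C (d.eval (c : K)) = 1 := by
        rw [← C_mul, inv_mul_cancel₀ hc, C_1]
      rw [coe_evalRingHom] at h1
      rw [← h2, ← h1]
      ring
    rw [← derivative_map, e1, derivative_scaleRoots]
    exact hcop.scaleRoots _ _ _ hsK.isUnit
  obtain ⟨a, b, δ, hδ0, hδ⟩ : ∃ (a b : (𝓞 K)[X]) (δ : ℕ), δ ≠ 0 ∧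
      a * f2.map (evalRingHom 0) + b * derivative (f2.map (evalRingHom 0)) = C (δ : 𝓞 K) := by
    obtain ⟨a, b, hab⟩ := hsep
    obtain ⟨⟨r, hr0⟩, hr⟩ := IsLocalization.exist_integer_multiples_of_finset (nonZeroDivisors (𝓞 K))
      (a.support.image a.coeff ∪ b.support.image b.coeff)
    have hr0 : r ≠ 0 := nonZeroDivisors.ne_zero hr0
    have hl : ∀ a' : K[X], (∀ u ∈ a'.support, IsLocalization.IsInteger (𝓞 K) (r • a'.coeff u)) →
        ∃ a'' : (𝓞 K)[X], a''.map (algebraMap (𝓞 K) K) = C (r : K) * a' := by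
      intro a' ha'
      refine (mem_lifts _).1 ((lifts_iff_coeff_lifts _).2 fun u => ?_)
      rw [coeff_C_mul]
      by_cases hu : u ∈ a'.support
      · obtain ⟨z, hz⟩ := ha' u hu
        exact ⟨z, by rw [hz, Algebra.smul_def]⟩
      · exact ⟨0, by rw [notMem_support_iff.1 hu]; simp⟩
    obtain ⟨a', ha'⟩ := hl a fun u hu => hr _ (Finset.mem_union_left _ (Finset.mem_image_of_mem _ hu))
    obtain ⟨b', hb'⟩ := hl b fun u hu => hr _ (Finset.mem_union_right _ (Finset.mem_image_of_mem _ hu))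
    obtain ⟨w, hw⟩ : r ∣ (Ideal.absNorm (Ideal.span {r}) : 𝓞 K) :=
      Ideal.mem_span_singleton.1 (Ideal.absNorm_mem _)
    refine ⟨C w * a', C w * b', Ideal.absNorm (Ideal.span {r}), ?_, ?_⟩
    · rw [Ne, Ideal.absNorm_eq_zero_iff]; simpa using hr0
    · rw [hw]
      apply Polynomial.map_injective (algebraMap (𝓞 K) K) (IsFractionRing.injective _ _)
      rw [Polynomial.map_add, Polynomial.map_mul, Polynomial.map_mul, Polynomial.map_mul,
        Polynomial.map_mul, ha', hb', map_C, map_C, map_mul, C_mul]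
      linear_combination (C (algebraMap (𝓞 K) K r) * C (algebraMap (𝓞 K) K w)) * hab
  filter_upwards [Filter.eventually_gt_atTop δ] with p hp hpp
  obtain ⟨m, hm⟩ := card_parameters_with_root_le f2 hf2m (by rw [hf2]; exact hf2'irr)
    (by rw [hf2D, hf2', natDegree_scaleRoots, hf1D]; exact hD) a b δ p hpp
    (Nat.not_dvd_of_pos_of_lt (Nat.pos_of_ne_zero hδ0) hp) hδ
  refine ⟨m, fun N => ?_⟩
  filter_upwards [hm N] with k hk
  refine (Set.ncard_le_ncard ?_ ((Set.finite_lt_nat N).subset fun i hi => hi.1)).trans hk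
  rintro i ⟨hi, x, hx⟩
  refine ⟨hi, ?_⟩
  have e1 : ev (RingHom.id K) ((i : K) * p ^ k) x f1 = 0 := by
    rw [hev1, ← hx]; push_cast; rfl
  have e2 : ev (RingHom.id K) ((i : K) * p ^ k) ((s : K) * x) f2' = 0 := by
    rw [ev, coe_eval₂RingHom] at e1 ⊢
    have := scaleRoots_eval₂_eq_zero (s := C (s : K)) _ e1
    simpa using this
  have e3 : IsIntegral ℤ ((s : K) * x) := by
    rw [← hf2, ev_map, RingHom.id_comp] at e2
    have h3 : (algebraMap (𝓞 K) K) ((i : 𝓞 K) * p ^ k) = (i : K) * p ^ k := by simp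
    rw [← h3, ev_apply] at e2
    have : IsIntegral (𝓞 K) ((s : K) * x) := by
      refine ⟨f2.map (evalRingHom ((i : 𝓞 K) * p ^ k)), hf2m.map _, ?_⟩
      rw [← eval_map, map_map, ← e2]
      congr 2
      ext <;> simp
    exact isIntegral_trans _ this
  obtain ⟨y, hy⟩ : ∃ y : 𝓞 K, (y : K) = (s : K) * x := ⟨⟨_, e3⟩, rfl⟩
  refine ⟨y, ?_⟩
  apply IsFractionRing.injective (𝓞 K) K
  rw [map_ev, map_zero, ← e2, ← hf2, ev_map,
    show algebraMap (𝓞 K) K y = (s : K) * x from hy]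
  simp

theorem exists_extend_of_isIntegral_of_injective {A B L : Type*} [CommRing A] [IsDomain A]
    [CommRing B] [IsDomain B] [Algebra A B] [Algebra.IsIntegral A B]
    (hinj : Function.Injective (algebraMap A B)) [Field L] [IsAlgClosed L] {φ : A →+* L}
    (hφ : Function.Injective φ) : ∃ ψ : B →+* L, ψ.comp (algebraMap A B) = φ := by
  let := φ.toAlgebra
  have : Module.IsTorsionFree A L := Module.isTorsionFree_iff_algebraMap_injective.2 hφ
  have : Module.IsTorsionFree A B := Module.isTorsionFree_iff_algebraMap_injective.2 hinj
  let ψ : B →ₐ[A] L := IsAlgClosed.lift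
  exact ⟨ψ, ψ.comp_algebraMap⟩

theorem exists_extend_of_isIntegral {A B L : Type*} [CommRing A] [CommRing B] [IsDomain B] [Algebra A B]
    [Algebra.IsIntegral A B] (hinj : Function.Injective (algebraMap A B)) [Field L] [IsAlgClosed L]
    (φ : A →+* L) : ∃ ψ : B →+* L, ψ.comp (algebraMap A B) = φ := by
  obtain ⟨P, hP⟩ : ∃ P, P = RingHom.ker φ := ⟨_, rfl⟩
  have hp : P.IsPrime := hP ▸ RingHom.ker_isPrime φ
  obtain ⟨Q, hQ, hQP⟩ := Ideal.exists_ideal_over_prime_of_isIntegral_of_isDomain (S := B) P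
    (by rw [(RingHom.injective_iff_ker_eq_bot _).1 hinj]; exact bot_le)
  have hlo : Q.LiesOver P := ⟨hQP.symm⟩
  obtain ⟨χ, hχ, hχ'⟩ : ∃ χ : A ⧸ P →+* L, Function.Injective χ ∧ ∀ a, χ (Ideal.Quotient.mk P a) = φ a := by
    subst hP
    exact ⟨RingHom.kerLift φ, RingHom.kerLift_injective φ, RingHom.kerLift_mk φ⟩
  obtain ⟨ψ, hψ⟩ := exists_extend_of_isIntegral_of_injective (B := B ⧸ Q)
    (FaithfulSMul.algebraMap_injective (A ⧸ P) (B ⧸ Q)) hχ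
  refine ⟨ψ.comp (Ideal.Quotient.mk Q), ?_⟩
  ext a
  rw [← hχ' a, ← hψ]
  rfl

theorem exists_le_map_eq {α β : Type*} (f : α → β) {s : Multiset α} {t : Multiset β} (h : t ≤ s.map f) :
    ∃ u ≤ s, u.map f = t := by
  classical
  induction s using Multiset.induction_on generalizing t with
  | empty => exact ⟨0, le_rfl, by simpa [eq_comm] using h⟩
  | cons a s ih =>
    by_cases ha : f a ∈ t
    · obtain ⟨t', rfl⟩ := Multiset.exists_cons_of_mem ha
      rw [Multiset.map_cons, Multiset.cons_le_cons_iff] at h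
      obtain ⟨u, hu, rfl⟩ := ih h
      exact ⟨a ::ₘ u, Multiset.cons_le_cons _ hu, by simp⟩
    · rw [Multiset.map_cons, Multiset.le_cons_of_notMem ha] at h
      obtain ⟨u, hu, rfl⟩ := ih h
      exact ⟨u, hu.trans (Multiset.le_cons_self _ _), rfl⟩

theorem thin_not_irreducible {K : Type*} [Field K] [NumberField K] (f : K[X][X]) (hf : f.Monic)
    (hirr : Irreducible f) : Thin {t | ¬ Irreducible (f.map (evalRingHom (t : K)))} := by
  classical
  let Ω := AlgebraicClosure (FractionRing K[X])
  let R := integralClosure K[X] Ω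
  have hinjΩ : Function.Injective (algebraMap K[X] Ω) := by
    rw [IsScalarTower.algebraMap_eq K[X] (FractionRing K[X]) Ω]
    exact (algebraMap (FractionRing K[X]) Ω).injective.comp (IsFractionRing.injective _ _)
  have hinj : Function.Injective (algebraMap K[X] R) := by
    have : algebraMap K[X] Ω = (algebraMap R Ω).comp (algebraMap K[X] R) := rfl
    rw [this, RingHom.coe_comp] at hinjΩ
    exact hinjΩ.of_comp
  obtain ⟨S, hS⟩ : ∃ S : Multiset R, f.map (algebraMap K[X] R) = (S.map fun y => X - C y).prod := by
    have hsp : (f.map (algebraMap K[X] Ω)).Splits := IsAlgClosed.splits _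
    have h1 := hsp.eq_prod_roots_of_monic (hf.map _)
    obtain ⟨S, hS⟩ : ∃ S : Multiset R, S.map (algebraMap R Ω) = (f.map (algebraMap K[X] Ω)).roots := by
      have hR : ∀ x ∈ (f.map (algebraMap K[X] Ω)).roots, x ∈ R := fun x hx => by
        refine ⟨f, hf, ?_⟩
        rw [mem_roots (hf.map _).ne_zero, IsRoot.def, eval_map] at hx
        exact hx
      refine ⟨(f.map (algebraMap K[X] Ω)).roots.pmap (fun x hx => (⟨x, hx⟩ : R)) hR, ?_⟩
      rw [Multiset.map_pmap]
      exact (Multiset.pmap_eq_map _ id _ _).trans (Multiset.map_id _)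
    refine ⟨S, Polynomial.map_injective (algebraMap R Ω) Subtype.coe_injective ?_⟩
    rw [map_map, Polynomial.map_multiset_prod, Multiset.map_map]
    change f.map (algebraMap K[X] Ω) = _
    rw [h1, ← hS, Multiset.map_map]
    congr 1
    refine Multiset.map_congr rfl fun y _ => ?_
    simp only [Function.comp, Polynomial.map_sub, map_X, map_C]
  let g : Multiset R → R[X] := fun T => (T.map fun y => X - C y).prod
  have hgm : ∀ T, (g T).Monic := fun T => monic_multiset_prod_of_monic _ _ fun y _ => monic_X_sub_C y
  have hgd : ∀ T, (g T).natDegree = T.card := fun T => by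
    simp only [g, natDegree_multiset_prod_X_sub_C_eq_card]
  have hfd : f.natDegree = S.card := by
    rw [← hgd, show g S = f.map (algebraMap K[X] R) from hS.symm, natDegree_map_eq_of_injective hinj]
  have hcoef : ∀ T ≤ S, T ≠ 0 → T ≠ S → ∃ j, (g T).coeff j ∉ (algebraMap K[X] R).range := by
    intro T hT h0 hne
    by_contra! hcon
    obtain ⟨u, hu, hud, hum⟩ := lifts_and_natDegree_eq_and_monic
      ((lifts_iff_coeff_lifts _).2 hcon) (hgm T)
    have hdvd : u ∣ f := by
      rw [← map_dvd_map (algebraMap K[X] R) hinj hum, hu, hS]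
      exact Multiset.prod_dvd_prod_of_le (Multiset.map_le_map hT)
    obtain ⟨v, rfl⟩ := hdvd
    have hvm := hum.of_mul_monic_left hf
    have hTS : T.card < S.card := Multiset.card_lt_card (lt_of_le_of_ne hT hne)
    have hT0 : T.card ≠ 0 := by simpa using h0
    rw [hum.natDegree_mul hvm, hud, hgd] at hfd
    rcases (hf.irreducible_iff_natDegree.1 hirr).2 u v hum hvm rfl with h | h
    · rw [hud, hgd] at h; exact hT0 h
    · omega
  let W : Set R := (⋃ T ∈ S.powerset.toFinset, ((g T).coeffs : Set R)) \ (algebraMap K[X] R).range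
  have hWfin : W.Finite := ((Set.Finite.biUnion (Finset.finite_toSet _)
    fun T _ => Finset.finite_toSet _)).subset Set.sdiff_subset
  have hint : ∀ ω : R, IsIntegral K[X] ω := fun ω => Algebra.IsIntegral.isIntegral ω
  have hthin := thin_biUnion (B := fun ω => {t | ∃ x : K, ev (RingHom.id K) (t : K) x (minpoly K[X] ω) = 0})
    hWfin fun ω hω => thin_root _ (minpoly.monic (hint ω)) (minpoly.irreducible (hint ω)) (by
      have h1 := minpoly.natDegree_pos (hint ω)
      by_contra! h2
      refine hω.2 (minpoly.mem_range_of_degree_eq_one K[X] ω ?_)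
      rw [← Nat.cast_one, degree_eq_iff_natDegree_eq_of_pos one_pos]
      omega)
  refine hthin.mono fun t ht => ?_
  rw [Set.mem_ofPred_eq, (hf.map _).irreducible_iff_natDegree] at ht
  push Not at ht
  obtain ⟨a, b, ham, hbm, hab, ha0, hb0⟩ := ht (by
    intro h
    have := congrArg natDegree h
    rw [hf.natDegree_map, natDegree_one] at this
    exact (hf.irreducible_iff_natDegree.1 hirr).1 (hf.natDegree_eq_zero.1 this))
  let L := AlgebraicClosure K
  obtain ⟨π, hπ⟩ := exists_extend_of_isIntegral (B := R) hinj
    ((algebraMap K L).comp (evalRingHom (t : K)))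
  have hprod : ∀ T, (g T).map π = ((T.map π).map fun y => X - C y).prod := fun T => by
    simp only [g, Polynomial.map_multiset_prod, Multiset.map_map]
    simp
  have h1 : (a.map (algebraMap K L)) * (b.map (algebraMap K L)) = (g S).map π := by
    rw [← Polynomial.map_mul, hab, map_map, ← hπ, ← map_map, hS]
  have h2 : (a.map (algebraMap K L)).roots ≤ S.map π := by
    rw [← roots_multiset_prod_X_sub_C (S.map π), ← hprod, ← h1]
    exact roots.le_of_dvd (((ham.map _).mul (hbm.map _)).ne_zero) (dvd_mul_right _ _)
  obtain ⟨T, hTS, hT⟩ := exists_le_map_eq _ h2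
  have h3 : a.map (algebraMap K L) = (g T).map π := by
    rw [hprod, hT]
    exact (IsAlgClosed.splits _).eq_prod_roots_of_monic (ham.map _)
  have hTa : T.card = a.natDegree := by
    rw [← hgd, ← (hgm T).natDegree_map π, ← h3, ham.natDegree_map]
  have hSab : S.card = a.natDegree + b.natDegree := by
    rw [← hfd, ← ham.natDegree_mul hbm, hab, hf.natDegree_map]
  obtain ⟨j, hj⟩ := hcoef T hTS (by rintro rfl; simp at hTa; omega) (by rintro rfl; omega)
  refine Set.mem_iUnion₂.2 ⟨(g T).coeff j, ⟨Set.mem_iUnion₂.2 ⟨T, by simpa using hTS, ?_⟩, hj⟩, a.coeff j, ?_⟩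
  · refine Finset.mem_coe.2 (coeff_mem_coeffs ?_)
    intro h
    exact hj (h ▸ Subring.zero_mem _)
  · apply (algebraMap K L).injective
    have h4 := congrArg (fun q => q.coeff j) h3
    simp only [coeff_map] at h4
    have h5 := congrArg π (minpoly.aeval K[X] ((g T).coeff j))
    rw [aeval_def, hom_eval₂, hπ, map_zero] at h5
    rw [map_ev, map_zero, ev_apply, eval_map, h4, ← h5]
    congr 1
    ext <;> simp

theorem irreducible_of_irreducible_map_mapRingHom {A B : Type*} [CommRing A] [IsDomain A] [CommRing B] [IsDomain B]
    (φ : A →+* B) {q : A[X][X]} (hq : q.Monic) (h : Irreducible (q.map (mapRingHom φ))) :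
    Irreducible q :=
  hq.irreducible_of_irreducible_map _ _ h

theorem map_eval_eq_aeval_ev {K Ω : Type*} [Field K] [CommRing Ω] [Algebra K Ω] (t : K) (y : Ω) (q : K[X][X]) :
    aeval y (q.map (evalRingHom t)) = ev (algebraMap K Ω) (algebraMap K Ω t) y q := by
  rw [ev_apply, aeval_def, ← eval_map, map_map]
  congr 2
  ext <;> simp

open IntermediateField in
theorem exists_specialization {K L Ω : Type*} [Field K] [NumberField K] [Field L] [NumberField L] [Field Ω]
    [IsAlgClosed Ω] [Algebra K L] [Algebra L Ω] [Algebra K Ω] [IsScalarTower K L Ω] [CharZero Ω]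
    (q f : K[X][X]) (g : K[X]) {r : ℕ} (h : Fin r → K[X][X]) (D lam : Fin r → K[X]) (hq : q.Monic)
    (hqirr : Irreducible (q.map (mapRingHom (algebraMap K Ω)))) (hg : g ≠ 0) (hhm : ∀ l, (h l).Monic)
    (hhirr : ∀ l, Irreducible (h l)) (hhdeg : ∀ l, q.natDegree < (h l).natDegree)
    (hcov : ∀ t y w : Ω, ev (algebraMap K Ω) t y q = 0 → ev (algebraMap K Ω) t w f = 0 →
      ∃ l, ev (algebraMap K Ω) t ((D l).eval₂ (algebraMap K Ω) t * w + (lam l).eval₂ (algebraMap K Ω) t * y)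
        (h l) = 0) :
    ∃ (t : ℚ) (y : Ω), ¬ IsIntegral ℤ t ∧ g.eval (t : K) ≠ 0 ∧ ev (algebraMap K Ω) t y q = 0 ∧
      (∀ b : L, algebraMap L Ω b ∈ K⟮y⟯ → b ∈ (algebraMap K L).range) ∧
      ∀ w ∈ K⟮y⟯, ev (algebraMap K Ω) t w f ≠ 0 := by
  classical
  have hmapmap : (q.map (mapRingHom (algebraMap K L))).map (mapRingHom (algebraMap L Ω)) =
      q.map (mapRingHom (algebraMap K Ω)) := by
    rw [Polynomial.map_map, IsScalarTower.algebraMap_eq K L Ω, mapRingHom_comp]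
  have hqL : Irreducible (q.map (mapRingHom (algebraMap K L))) :=
    irreducible_of_irreducible_map_mapRingHom (algebraMap L Ω) (hq.map _) (by rwa [hmapmap])
  have hthin := ((thin_not_irreducible _ (hq.map _) hqL).union
    (thin_biUnion (Set.finite_univ (α := Fin r)) fun l _ =>
      thin_not_irreducible _ (hhm l) (hhirr l))).union (thin_of_finite (B := {t : ℚ | g.eval (t : K) = 0}) (by
        have : {x : K | g.eval x = 0}.Finite := by
          refine (g.roots.toFinset.finite_toSet).subset fun x hx => ?_
          simpa [hg] using hx
        simpa using this.preimage (f := fun c : ℚ => (c : K)) Rat.cast_injective.injOn))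
  obtain ⟨t, ht, htint⟩ := hthin.exists_notMem
  simp only [Set.mem_union, Set.mem_iUnion, Set.mem_ofPred_eq, not_or, not_not, not_exists] at ht
  obtain ⟨⟨htq, hth⟩, htg⟩ := ht
  have hn : q.natDegree ≠ 0 := fun h0 => by
    rw [hq.natDegree_eq_zero.1 h0] at hqirr
    simp at hqirr
  obtain ⟨y, hy⟩ := IsAlgClosed.exists_aeval_eq_zero Ω (q.map (evalRingHom (t : K)))
    (by rw [degree_eq_natDegree (hq.map _).ne_zero, hq.natDegree_map]; exact_mod_cast hn)
  have htcast : algebraMap K Ω (t : K) = (t : Ω) := map_ratCast _ _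
  have htL : algebraMap K L (t : K) = (t : L) := map_ratCast _ _
  have e1 : (q.map (mapRingHom (algebraMap K L))).map (evalRingHom (t : L)) =
      (q.map (evalRingHom (t : K))).map (algebraMap K L) := by
    rw [Polynomial.map_map, Polynomial.map_map]
    congr 1
    ext <;> simp
  have hyL : (q.map (evalRingHom (t : K))).map (algebraMap K L) = minpoly L y := by
    refine minpoly.eq_of_irreducible_of_monic (e1 ▸ htq) ?_ ((hq.map _).map _)
    rw [aeval_map_algebraMap, hy]
  have hyK : q.map (evalRingHom (t : K)) = minpoly K y :=
    minpoly.eq_of_irreducible_of_monic ((hq.map _).irreducible_of_irreducible_map (algebraMap K L) _ (e1 ▸ htq))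
      hy (hq.map _)
  have hyint : IsIntegral K y := ⟨_, hq.map _, hy⟩
  have hdK : (minpoly K y).natDegree = q.natDegree := by rw [← hyK, hq.natDegree_map]
  have hdL : (minpoly L y).natDegree = q.natDegree := by
    rw [← hyL, (hq.map _).natDegree_map, hq.natDegree_map]
  have hfin : Module.finrank K K⟮y⟯ = q.natDegree := by rw [adjoin.finrank hyint, hdK]
  have hfd : FiniteDimensional K K⟮y⟯ := adjoin.finiteDimensional hyint
  refine ⟨t, y, htint, htg, ?_, fun b hb => ?_, fun w hw hfw => ?_⟩
  · rw [← htcast, ← map_eval_eq_aeval_ev, hy]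
  · rw [← mem_toSubalgebra, adjoin_simple_toSubalgebra_of_isAlgebraic hyint.isAlgebraic,
      Algebra.adjoin_singleton_eq_range_aeval] at hb
    obtain ⟨u, hu⟩ := hb
    have hu' : aeval y (u %ₘ minpoly K y) = algebraMap L Ω b := by
      rw [← hu, Polynomial.aeval_modByMonic_eq_self_of_root (minpoly.aeval K y)]; rfl
    set v := u %ₘ minpoly K y with hv
    have hvd : v.natDegree < q.natDegree := by
      rw [← hdK]
      exact natDegree_modByMonic_lt _ (minpoly.monic hyint) (fun h1 => by
        rw [h1, natDegree_one] at hdK; exact hn hdK.symm)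
    have hz : v.map (algebraMap K L) - C b = 0 := by
      by_contra hne
      have h1 := natDegree_le_natDegree (minpoly.degree_le_of_ne_zero L y hne (by
        rw [map_sub, aeval_map_algebraMap, hu', aeval_C, sub_self]))
      rw [hdL, natDegree_sub_C, natDegree_map] at h1
      omega
    refine ⟨v.coeff 0, ?_⟩
    have := congrArg (fun p => p.coeff 0) hz
    simp only [coeff_sub, coeff_map, coeff_C_zero, coeff_zero, sub_eq_zero] at this
    exact this
  · rw [← htcast] at hfw
    have hyq : ev (algebraMap K Ω) (algebraMap K Ω t) y q = 0 := by rw [← map_eval_eq_aeval_ev, hy]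
    obtain ⟨l, hl⟩ := hcov _ y w hyq hfw
    rw [eval₂_at_apply, eval₂_at_apply, ← map_eval_eq_aeval_ev] at hl
    set z := algebraMap K Ω ((D l).eval (t : K)) * w + algebraMap K Ω ((lam l).eval (t : K)) * y with hz
    have hzm : z ∈ K⟮y⟯ := add_mem (mul_mem (IntermediateField.algebraMap_mem _ _) hw)
      (mul_mem (IntermediateField.algebraMap_mem _ _) (mem_adjoin_simple_self K y))
    have h2 : (h l).map (evalRingHom (t : K)) = minpoly K z :=
      minpoly.eq_of_irreducible_of_monic (hth l trivial) hl ((hhm l).map _)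
    have h3 := minpoly.natDegree_le (A := K) (⟨z, hzm⟩ : K⟮y⟯)
    have h4 : minpoly K (⟨z, hzm⟩ : K⟮y⟯) = minpoly K z :=
      (minpoly.algebraMap_eq (algebraMap K⟮y⟯ Ω).injective _).symm
    rw [h4, ← h2, (hhm l).natDegree_map, hfin] at h3
    exact absurd (hhdeg l) (by omega)

theorem isOpen_setOf_mem (x : Qbar) : IsOpen {F : Subfield Qbar | x ∈ F} ∧ IsOpen {F : Subfield Qbar | x ∉ F} := by
  let := propDiscrete
  have : DiscreteTopology Prop := ⟨rfl⟩
  have h1 : @Continuous _ _ powersetTopology propDiscrete (fun s : Set Qbar => s x) :=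
    continuous_apply (A := fun _ : Qbar => Prop) x
  have h2 : @Continuous _ _ subfieldTopology powersetTopology (fun F : Subfield Qbar => (F : Set Qbar)) :=
    continuous_induced_dom
  have hc : Continuous fun F : Subfield Qbar => (x ∈ F : Prop) :=
    @Continuous.comp _ _ _ subfieldTopology powersetTopology propDiscrete _ _ h1 h2
  constructor
  · have := (isOpen_discrete {True}).preimage hc
    simpa [Set.preimage] using this
  · have := (isOpen_discrete {False}).preimage hc
    simpa [Set.preimage] using this

theorem exists_finset_of_isOpen {U : Set (Subfield Qbar)} (hU : IsOpen U) {F : Subfield Qbar} (hF : F ∈ U) :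
    ∃ A B : Finset Qbar, (∀ a ∈ A, a ∈ F) ∧ (∀ b ∈ B, b ∉ F) ∧
      ∀ F' : Subfield Qbar, (∀ a ∈ A, a ∈ F') → (∀ b ∈ B, b ∉ F') → F' ∈ U := by
  classical
  let := propDiscrete
  obtain ⟨V, hV, rfl⟩ := (@isOpen_induced_iff _ _ powersetTopology _ _).1 hU
  obtain ⟨I, u, hu, hIu⟩ := isOpen_pi_iff.1 hV (F : Set Qbar) hF
  refine ⟨I.filter (· ∈ F), I.filter (· ∉ F), by simp, by simp, fun F' hA hB => hIu fun a ha => ?_⟩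
  have : (F' : Set Qbar) a = (F : Set Qbar) a := by
    by_cases h : a ∈ F
    · exact propext ⟨fun _ => h, fun _ => hA a (by simpa using ⟨ha, h⟩)⟩
    · exact propext ⟨fun h' => absurd h' (hB a (by simpa using ⟨ha, h⟩)), fun h' => absurd h' h⟩
  change (F' : Set Qbar) a ∈ u a
  rw [this]
  exact (hu a ha).2

/-- Data for a specialization problem over a field `F` inside `Ω`. -/
structure Admissible {F Ω : Type*} [Field F] [Field Ω] (ι : F →+* Ω) (q f : F[X][X]) (g : F[X]) {r : ℕ}
    (h : Fin r → F[X][X]) (D lam : Fin r → F[X]) : Prop where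
  monic : q.Monic
  irreducible : Irreducible (q.map (mapRingHom ι))
  monic_avoid : f.Monic
  ne_zero : g ≠ 0
  monic_cover : ∀ l, (h l).Monic
  irreducible_cover : ∀ l, Irreducible (h l)
  natDegree_lt : ∀ l, q.natDegree < (h l).natDegree
  cover : ∀ t y w : Ω, ev ι t y q = 0 → ev ι t w f = 0 →
    ∃ l, ev ι t ((D l).eval₂ ι t * w + (lam l).eval₂ ι t * y) (h l) = 0

/-- Every specialization problem has a solution, with parameter satisfying `N`. -/
def HasSpecializations {F Ω : Type*} [Field F] [Field Ω] (ι : F →+* Ω) (N : F → Prop) : Prop :=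
  ∀ ⦃q f : F[X][X]⦄ ⦃g : F[X]⦄ ⦃r : ℕ⦄ ⦃h : Fin r → F[X][X]⦄ ⦃D lam : Fin r → F[X]⦄,
    Admissible ι q f g h D lam →
      ∃ t y : F, N t ∧ g.eval t ≠ 0 ∧ ev (RingHom.id F) t y q = 0 ∧ ∀ x, ev (RingHom.id F) t x f ≠ 0

theorem exists_map_algebraMap_eq {F Ω : Type*} [Field F] [Field Ω] (ι : F →+* Ω) (p : F[X]) {k : Type*} [Field k]
    [Algebra k Ω] (K : IntermediateField k Ω) (hK : ∀ c ∈ p.coeffs, ι c ∈ K) :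
    ∃ p' : K[X], p'.map (algebraMap K Ω) = p.map ι := by
  refine (mem_lifts _).1 ((lifts_iff_coeff_lifts _).2 fun j => ?_)
  rw [coeff_map]
  by_cases h : p.coeff j = 0
  · exact ⟨0, by simp [h]⟩
  · exact ⟨⟨_, hK _ (coeff_mem_coeffs h)⟩, rfl⟩

theorem exists_map_mapRingHom_eq {F Ω : Type*} [Field F] [Field Ω] (ι : F →+* Ω) (p : F[X][X]) {k : Type*} [Field k]
    [Algebra k Ω] (K : IntermediateField k Ω) (hK : ∀ u ∈ p.coeffs, ∀ c ∈ u.coeffs, ι c ∈ K) :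
    ∃ p' : K[X][X], p'.map (mapRingHom (algebraMap K Ω)) = p.map (mapRingHom ι) := by
  refine (mem_lifts _).1 ((lifts_iff_coeff_lifts _).2 fun j => ?_)
  rw [coeff_map]
  by_cases h : p.coeff j = 0
  · exact ⟨0, by simp [h]⟩
  · exact exists_map_algebraMap_eq ι _ K (hK _ (coeff_mem_coeffs h))

theorem Admissible.exists_subfield {F : Subfield Qbar} {q f : F[X][X]} {g : F[X]} {r : ℕ}
    {h : Fin r → F[X][X]} {D lam : Fin r → F[X]} (H : Admissible F.subtype q f g h D lam) {A B : Finset Qbar}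
    (hA : ∀ a ∈ A, a ∈ F) (hB : ∀ b ∈ B, b ∉ F) :
    ∃ (t : ℚ) (y : Qbar) (F' : Subfield Qbar), (∀ a ∈ A, a ∈ F') ∧ (∀ b ∈ B, b ∉ F') ∧ ¬ IsIntegral ℤ t ∧
      y ∈ F' ∧ g.eval₂ F.subtype t ≠ 0 ∧ ev F.subtype t y q = 0 ∧ ∀ w ∈ F', ev F.subtype t w f ≠ 0 := by
  classical
  let c1 : F[X] → Finset Qbar := fun p => p.coeffs.image F.subtype
  let c2 : F[X][X] → Finset Qbar := fun p => p.coeffs.biUnion c1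
  have hc1F : ∀ p, ∀ x ∈ c1 p, x ∈ F := by
    intro p x hx
    obtain ⟨c, -, rfl⟩ := Finset.mem_image.1 hx
    exact c.2
  have hc2F : ∀ p, ∀ x ∈ c2 p, x ∈ F := by
    intro p x hx
    obtain ⟨u, -, hu⟩ := Finset.mem_biUnion.1 hx
    exact hc1F _ _ hu
  obtain ⟨S, hSF, hSA, hSq, hSf, hSg, hSh, hSD, hSl⟩ : ∃ S : Finset Qbar, (∀ x ∈ S, x ∈ F) ∧ A ⊆ S ∧ c2 q ⊆ S ∧
      c2 f ⊆ S ∧ c1 g ⊆ S ∧ (∀ l, c2 (h l) ⊆ S) ∧ (∀ l, c1 (D l) ⊆ S) ∧ ∀ l, c1 (lam l) ⊆ S := by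
    refine ⟨A ∪ (c2 q ∪ (c2 f ∪ (c1 g ∪ (Finset.univ.biUnion fun l => c2 (h l) ∪ (c1 (D l) ∪ c1 (lam l)))))),
      ?_, fun x hx => by simp [hx], fun x hx => by simp [hx], fun x hx => by simp [hx],
      fun x hx => by simp [hx], fun l x hx => ?_, fun l x hx => ?_, fun l x hx => ?_⟩
    rotate_left
    iterate 3
      simp only [Finset.mem_union, Finset.mem_biUnion, Finset.mem_univ, true_and]
      exact Or.inr (Or.inr (Or.inr (Or.inr ⟨l, by simp [hx]⟩)))
    intro x hx
    simp only [Finset.mem_union, Finset.mem_biUnion, Finset.mem_univ, true_and] at hx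
    rcases hx with hx | hx | hx | hx | ⟨l, hx | hx | hx⟩
    exacts [hA x hx, hc2F _ x hx, hc2F _ x hx, hc1F _ x hx, hc2F _ x hx, hc1F _ x hx, hc1F _ x hx]
  let K : IntermediateField ℚ Qbar := IntermediateField.adjoin ℚ (S : Set Qbar)
  let L : IntermediateField ℚ Qbar := IntermediateField.adjoin ℚ ((S ∪ B : Finset Qbar) : Set Qbar)
  have hint : ∀ x : Qbar, IsIntegral ℚ x := fun x =>
    ((AlgebraicClosure.isAlgebraic ℚ).isAlgebraic x).isIntegral
  have hKf : FiniteDimensional ℚ K := IntermediateField.finiteDimensional_adjoin fun x _ => hint x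
  have hLf : FiniteDimensional ℚ L := IntermediateField.finiteDimensional_adjoin fun x _ => hint x
  have hKn : NumberField K := ⟨⟩
  have hLn : NumberField L := ⟨⟩
  have hKL : K ≤ L := IntermediateField.adjoin.mono _ _ _ (by simp)
  let := (IntermediateField.inclusion hKL).toRingHom.toAlgebra
  have : IsScalarTower K L Qbar := IsScalarTower.of_algebraMap_eq fun _ => rfl
  have hSK : ∀ x ∈ S, x ∈ K := fun x hx => IntermediateField.subset_adjoin _ _ hx
  have hKF : ∀ x ∈ K, x ∈ F := by
    have : K.toSubfield ≤ F := by
      rw [IntermediateField.adjoin_toSubfield, Subfield.closure_le]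
      refine Set.union_subset ?_ hSF
      rintro _ ⟨x, rfl⟩
      rw [eq_ratCast]
      exact SubfieldClass.ratCast_mem F x
    exact this
  let κ : K →+* F := (Subfield.inclusion (show K.toSubfield ≤ F from hKF))
  have hκ : F.subtype.comp κ = algebraMap K Qbar := rfl
  have hl1 : ∀ p : F[X], c1 p ⊆ S → ∃ p' : K[X], p'.map κ = p := fun p hp => by
    obtain ⟨p', hp'⟩ := exists_map_algebraMap_eq F.subtype p K fun c hc =>
      hSK _ (hp (Finset.mem_image_of_mem _ hc))
    refine ⟨p', Polynomial.map_injective F.subtype F.subtype.injective ?_⟩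
    rw [map_map, hκ, hp']
  have hl2 : ∀ p : F[X][X], c2 p ⊆ S → ∃ p' : K[X][X], p'.map (mapRingHom κ) = p := fun p hp => by
    obtain ⟨p', hp'⟩ := exists_map_mapRingHom_eq F.subtype p K fun u hu c hc =>
      hSK _ (hp (Finset.mem_biUnion.2 ⟨u, hu, Finset.mem_image_of_mem _ hc⟩))
    refine ⟨p', Polynomial.map_injective (mapRingHom F.subtype)
      (Polynomial.map_injective F.subtype F.subtype.injective) ?_⟩
    rw [map_map, mapRingHom_comp, hκ, hp']
  obtain ⟨q', rfl⟩ := hl2 q hSq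
  obtain ⟨f', rfl⟩ := hl2 f hSf
  obtain ⟨g', rfl⟩ := hl1 g hSg
  choose h' hh' using fun l => hl2 (h l) (hSh l)
  choose D' hD' using fun l => hl1 (D l) (hSD l)
  choose lam' hlam' using fun l => hl1 (lam l) (hSl l)
  obtain rfl : (fun l => (h' l).map (mapRingHom κ)) = h := funext hh'
  obtain rfl : (fun l => (D' l).map κ) = D := funext hD'
  obtain rfl : (fun l => (lam' l).map κ) = lam := funext hlam'
  have hinj2 : Function.Injective (mapRingHom κ) := Polynomial.map_injective κ κ.injective
  have hm : ∀ p : K[X][X], (p.map (mapRingHom κ)).Monic → p.Monic := fun p hp =>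
    monic_of_injective hinj2 hp
  have hcov := H.cover
  simp only [ev_map, eval₂_map, hκ] at hcov ⊢
  obtain ⟨t, y, ht, hg, hq, hb, hf⟩ := exists_specialization (K := K) (L := L) (Ω := Qbar) q' f' g' h' D' lam'
    (hm _ H.monic) (by
      have := H.irreducible
      rwa [map_map, mapRingHom_comp, hκ] at this)
    (by rintro rfl; exact H.ne_zero (by simp)) (fun l => hm _ (H.monic_cover l))
    (fun l => irreducible_of_irreducible_map_mapRingHom κ (hm _ (H.monic_cover l)) (H.irreducible_cover l))
    (fun l => by
      have := H.natDegree_lt l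
      rwa [natDegree_map_eq_of_injective hinj2, natDegree_map_eq_of_injective hinj2] at this)
    hcov
  refine ⟨t, y, (IntermediateField.adjoin K {y}).toSubfield, fun a ha => ?_, fun b hbB hbF => ?_, ht,
    IntermediateField.mem_adjoin_simple_self K y, fun h0 => hg ?_, hq, hf⟩
  · exact IntermediateField.algebraMap_mem _ (⟨a, hSK a (hSA ha)⟩ : K)
  · obtain ⟨⟨x, hx⟩, hx'⟩ := hb ⟨b, IntermediateField.subset_adjoin _ _ (by simp [hbB])⟩ hbF
    have : x = b := congrArg Subtype.val hx'
    exact hB b hbB (hKF _ (this ▸ hx))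
  · apply (algebraMap K Qbar).injective
    rw [← eval₂_at_apply, map_ratCast, h0, map_zero]

instance countable_polynomial {R : Type*} [Semiring R] [Countable R] : Countable R[X] := by
  rw [← Cardinal.mk_le_aleph0_iff]
  exact cardinalMk_le_max.trans (max_le (Cardinal.mk_le_aleph0_iff.2 inferInstance) le_rfl)

theorem isNowhereDense_not_hasSpecializations (Q P : Qbar[X][X]) (G : Qbar[X]) (r : ℕ) (H : Fin r → Qbar[X][X])
    (E M : Fin r → Qbar[X]) :
    IsNowhereDense {F : Subfield Qbar | ∃ (q f : F[X][X]) (g : F[X]) (h : Fin r → F[X][X]) (D lam : Fin r → F[X]),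
      q.map (mapRingHom F.subtype) = Q ∧ f.map (mapRingHom F.subtype) = P ∧ g.map F.subtype = G ∧
      (∀ l, (h l).map (mapRingHom F.subtype) = H l) ∧ (∀ l, (D l).map F.subtype = E l) ∧
      (∀ l, (lam l).map F.subtype = M l) ∧ Admissible F.subtype q f g h D lam ∧
      ¬ ∃ t y : F, ¬ IsIntegral ℤ t ∧ g.eval t ≠ 0 ∧ ev (RingHom.id F) t y q = 0 ∧
        ∀ x, ev (RingHom.id F) t x f ≠ 0} := by
  classical
  set S := {F : Subfield Qbar | _} with hS
  rw [IsNowhereDense, Set.eq_empty_iff_forall_notMem]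
  intro F₀ hF₀
  obtain ⟨F, hFU, hFS⟩ := mem_closure_iff.1 (interior_subset hF₀) _ isOpen_interior hF₀
  obtain ⟨A, B, hA, hB, hAB⟩ := exists_finset_of_isOpen isOpen_interior hFU
  obtain ⟨q, f, g, h, D, lam, rfl, rfl, rfl, hh, hD, hl, hadm, -⟩ := hFS
  obtain ⟨t, y, F', hA', hB', ht, hy, hg, hq, hf⟩ := hadm.exists_subfield hA hB
  have hF' := interior_subset (hAB F' hA' hB')
  set p : Qbar[X] := f.map (eval₂RingHom F.subtype (t : Qbar)) with hp
  have hpm : p.Monic := hadm.monic_avoid.map _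
  have hpr : ∀ w, ev F.subtype (t : Qbar) w f = 0 ↔ w ∈ p.roots.toFinset := fun w => by
    rw [Multiset.mem_toFinset, mem_roots hpm.ne_zero, IsRoot.def, ev_apply]
  have hVo : IsOpen ({F : Subfield Qbar | y ∈ F} ∩ ⋂ w ∈ p.roots.toFinset, {F : Subfield Qbar | w ∉ F}) :=
    (isOpen_setOf_mem y).1.inter (isOpen_biInter_finset fun w _ => (isOpen_setOf_mem w).2)
  obtain ⟨F₁, ⟨hy₁, hw₁⟩, hS₁⟩ := mem_closure_iff.1 hF' _ hVo
    ⟨hy, Set.mem_iInter₂.2 fun w hw hwF => hf w hwF ((hpr w).2 hw)⟩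
  obtain ⟨q₁, f₁, g₁, h₁, D₁, lam₁, eq, ef, eg, -, -, -, -, hno⟩ := hS₁
  refine hno ⟨(t : F₁), ⟨y, hy₁⟩, fun hi => ht ?_, fun h0 => hg ?_, ?_, fun x hx => ?_⟩
  · rw [← eq_ratCast (algebraMap ℚ F₁)] at hi
    exact (isIntegral_algebraMap_iff (algebraMap ℚ F₁).injective).1 hi
  · have := congrArg F₁.subtype h0
    rw [← eval_map, ← eg, eval_map, ← map_ratCast F₁.subtype, eval₂_at_apply, h0, map_zero]
  · apply F₁.subtype.injective
    rw [map_ev, RingHom.comp_id, ← RingHom.id_comp F₁.subtype, ← ev_map, eq, ev_map, map_zero, map_ratCast]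
    exact hq
  · refine Set.mem_iInter₂.1 hw₁ x ((hpr x).1 ?_) x.2
    have := congrArg F₁.subtype hx
    rw [map_ev, RingHom.comp_id, ← RingHom.id_comp F₁.subtype, ← ev_map, ef, ev_map, map_zero, map_ratCast] at this
    exact this

theorem isMeagre_not_hasSpecializations :
    IsMeagre {F : Subfield Qbar | ¬ HasSpecializations F.subtype fun t : F => ¬ IsIntegral ℤ t} := by
  have hQ : Countable Qbar := by
    rw [← Cardinal.mk_le_aleph0_iff]
    have : Algebra.IsAlgebraic ℚ Qbar := AlgebraicClosure.isAlgebraic ℚ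
    exact (Algebra.IsAlgebraic.cardinalMk_le_max ℚ Qbar).trans (by simp)
  refine (isMeagre_iUnion fun d : (Qbar[X][X] × Qbar[X][X] × Qbar[X]) ×
    Σ r : ℕ, (Fin r → Qbar[X][X]) × (Fin r → Qbar[X]) × (Fin r → Qbar[X]) =>
    (isNowhereDense_not_hasSpecializations d.1.1 d.1.2.1 d.1.2.2 d.2.1 d.2.2.1 d.2.2.2.1 d.2.2.2.2).isMeagre).mono ?_
  intro F hF
  rw [Set.mem_ofPred_eq, HasSpecializations] at hF
  push Not at hF
  obtain ⟨q, f, g, r, h, D, lam, H, hno⟩ := hF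
  refine Set.mem_iUnion.2 ⟨⟨⟨q.map (mapRingHom F.subtype), f.map (mapRingHom F.subtype), g.map F.subtype⟩, r,
    fun l => (h l).map (mapRingHom F.subtype), fun l => (D l).map F.subtype, fun l => (lam l).map F.subtype⟩,
    q, f, g, h, D, lam, rfl, rfl, rfl, fun _ => rfl, fun _ => rfl, fun _ => rfl, H, ?_⟩
  push Not
  exact hno

theorem coeff_coeff_swap {R : Type*} [CommRing R] (p : R[X][X]) (j k : ℕ) :
    ((Bivariate.swap p).coeff k).coeff j = (p.coeff j).coeff k := by
  induction p using Polynomial.induction_on' with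
  | add p q hp hq => simp [hp, hq]
  | monomial n f =>
    induction f using Polynomial.induction_on' with
    | add p q hp hq => simp only [map_add, coeff_add, hp, hq]
    | monomial m r =>
      rw [Bivariate.swap_monomial_monomial]
      simp only [coeff_monomial]
      split_ifs <;> simp [coeff_monomial, *]

theorem natDegree_swap_le_iff {R : Type*} [CommRing R] (p : R[X][X]) (d : ℕ) :
    (Bivariate.swap p).natDegree ≤ d ↔ ∀ j, (p.coeff j).natDegree ≤ d := by
  simp only [natDegree_le_iff_coeff_eq_zero]
  constructor
  · intro h j N hN
    rw [← coeff_coeff_swap, h N hN, coeff_zero]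
  · intro h N hN
    ext j
    rw [coeff_coeff_swap, h j N hN, coeff_zero]

theorem exists_map_evalRingHom_eq {A : Type*} [CommRing A] (a : ℕ → A[X]) (n : ℕ) (h : ∀ i, (a i).natDegree ≤ n) :
    ∃ p : (ℕ → A)[X], ∀ i, p.map (Pi.evalRingHom (fun _ => A) i) = a i := by
  refine ⟨∑ j ∈ Finset.range (n + 1), monomial j fun i => (a i).coeff j, fun i => ?_⟩
  rw [Polynomial.map_sum, (a i).as_sum_range' (n + 1) (Nat.lt_succ_of_le (h i))]
  exact Finset.sum_congr rfl fun j _ => by simp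

theorem exists_map_mapRingHom_evalRingHom_eq {A : Type*} [CommRing A] (a : ℕ → A[X][X]) (n d : ℕ)
    (h : ∀ i, (a i).natDegree ≤ n) (h' : ∀ i j, ((a i).coeff j).natDegree ≤ d) :
    ∃ p : (ℕ → A)[X][X], ∀ i, p.map (mapRingHom (Pi.evalRingHom (fun _ => A) i)) = a i := by
  choose c hc using fun j => exists_map_evalRingHom_eq (fun i => (a i).coeff j) d fun i => h' i j
  refine ⟨∑ j ∈ Finset.range (n + 1), monomial j (c j), fun i => ?_⟩
  rw [Polynomial.map_sum, (a i).as_sum_range' (n + 1) (Nat.lt_succ_of_le (h i))]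
  exact Finset.sum_congr rfl fun j _ => by rw [map_monomial, coe_mapRingHom, hc]

/-- The ultrapower `F^ℕ / U` for a fixed nonprincipal ultrafilter `U`. -/
def Ultrapower (F : Type*) : Type _ := (Filter.hyperfilter ℕ : Filter ℕ).Germ F

namespace Ultrapower

/-- The fixed nonprincipal ultrafilter, used as a quantifier over almost all indices. -/
abbrev μ : Ultrafilter ℕ := Filter.hyperfilter ℕ

variable {F Ω : Type*} [Field F] [Field Ω]

instance : Field (Ultrapower F) := inferInstanceAs (Field ((Filter.hyperfilter ℕ : Filter ℕ).Germ F))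

variable (F) in
/-- The quotient map onto the ultrapower. -/
def mk : (ℕ → F) →+* Ultrapower F := Filter.Germ.coeRingHom _

theorem mk_surjective : Function.Surjective (mk F) := fun x => Quotient.inductionOn' x fun a => ⟨a, rfl⟩

theorem mk_eq_mk {a b : ℕ → F} : mk F a = mk F b ↔ ∀ᶠ i in μ, a i = b i := Filter.Germ.coe_eq

theorem mk_eq_zero {a : ℕ → F} : mk F a = 0 ↔ ∀ᶠ i in μ, a i = 0 := by
  rw [← map_zero (mk F), mk_eq_mk]; rfl

/-- The map of ultrapowers induced by a ring homomorphism. -/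
def map (ι : F →+* Ω) : Ultrapower F →+* Ultrapower Ω where
  toFun := Filter.Germ.map ι
  map_one' := congrArg (mk Ω) (funext fun _ => map_one ι)
  map_zero' := congrArg (mk Ω) (funext fun _ => map_zero ι)
  map_mul' x y := by
    obtain ⟨a, rfl⟩ := mk_surjective x
    obtain ⟨b, rfl⟩ := mk_surjective y
    exact congrArg (mk Ω) (funext fun i => map_mul ι (a i) (b i))
  map_add' x y := by
    obtain ⟨a, rfl⟩ := mk_surjective x
    obtain ⟨b, rfl⟩ := mk_surjective y
    exact congrArg (mk Ω) (funext fun i => map_add ι (a i) (b i))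

/-- A property holding for almost all entries of a representing sequence. -/
def Almost (N : F → Prop) (x : Ultrapower F) : Prop := ∃ a, mk F a = x ∧ ∀ᶠ i in μ, N (a i)

theorem almost_mk {N : F → Prop} {a : ℕ → F} : Almost N (mk F a) ↔ ∀ᶠ i in μ, N (a i) := by
  refine ⟨?_, fun h => ⟨a, rfl, h⟩⟩
  rintro ⟨b, hb, h⟩
  filter_upwards [mk_eq_mk.1 hb, h] with i h1 h2
  rwa [← h1]

/-- Projection to the `i`-th factor. -/
abbrev proj (F : Type*) [Field F] (i : ℕ) : (ℕ → F) →+* F := Pi.evalRingHom (fun _ => F) i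

theorem map_eq_zero_iff_of_eventually {R S : Type*} {T : ℕ → Type*} [CommRing R] [CommRing S] [∀ i, CommRing (T i)]
    {φ : R →+* S} {ψ : ∀ i, R →+* T i} (h : ∀ r, φ r = 0 ↔ ∀ᶠ i in μ, ψ i r = 0) (p : R[X]) :
    p.map φ = 0 ↔ ∀ᶠ i in μ, p.map (ψ i) = 0 := by
  constructor
  · intro hp
    have : ∀ᶠ i in μ, ∀ j ∈ p.support, ψ i (p.coeff j) = 0 := by
      rw [Filter.eventually_all_finset]
      intro j _
      rw [← h, ← coeff_map, hp, coeff_zero]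
    filter_upwards [this] with i hi
    ext j
    rw [coeff_map, coeff_zero]
    by_cases hj : j ∈ p.support
    · exact hi j hj
    · rw [notMem_support_iff.1 hj, map_zero]
  · intro hp
    ext j
    rw [coeff_map, coeff_zero, h]
    filter_upwards [hp] with i hi
    rw [← coeff_map, hi, coeff_zero]

theorem map_mk_eq_zero_iff (p : (ℕ → F)[X]) : p.map (mk F) = 0 ↔ ∀ᶠ i in μ, p.map (proj F i) = 0 :=
  map_eq_zero_iff_of_eventually (fun _ => mk_eq_zero) p

theorem map_mapRingHom_mk_eq_zero_iff (p : (ℕ → F)[X][X]) :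
    p.map (mapRingHom (mk F)) = 0 ↔ ∀ᶠ i in μ, p.map (mapRingHom (proj F i)) = 0 :=
  map_eq_zero_iff_of_eventually (ψ := fun i => mapRingHom (proj F i)) (fun p => map_mk_eq_zero_iff p) p

theorem mk_ev (t y : ℕ → F) (p : (ℕ → F)[X][X]) :
    ev (RingHom.id _) (mk F t) (mk F y) (p.map (mapRingHom (mk F))) =
      mk F fun i => ev (RingHom.id F) (t i) (y i) (p.map (mapRingHom (proj F i))) := by
  have h1 : ev (RingHom.id _) (mk F t) (mk F y) (p.map (mapRingHom (mk F))) =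
      mk F (ev (RingHom.id _) t y p) := by
    rw [map_ev, ev_map]; rfl
  rw [h1]
  congr 1
  ext i
  rw [ev_map]
  exact map_ev (proj F i) (RingHom.id _) t y p

theorem mk_eval (t : ℕ → F) (p : (ℕ → F)[X]) :
    (p.map (mk F)).eval (mk F t) = mk F fun i => (p.map (proj F i)).eval (t i) := by
  rw [eval_map, eval₂_at_apply]
  congr 1
  ext i
  rw [eval_map]
  exact (eval₂_at_apply (proj F i) t).symm

theorem eventually_irreducible (p : (ℕ → F)[X][X]) (hp : p.Monic)
    (h : Irreducible (p.map (mapRingHom (mk F)))) :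
    ∀ᶠ i in μ, Irreducible (p.map (mapRingHom (proj F i))) := by
  by_contra hcon
  rw [← Ultrafilter.eventually_not] at hcon
  obtain ⟨P, hP⟩ : ∃ P : ℕ → F[X][X], ∀ i, P i = p.map (mapRingHom (proj F i)) := ⟨_, fun _ => rfl⟩
  simp only [← hP] at hcon
  have hPm : ∀ i, (P i).Monic := fun i => hP i ▸ hp.map _
  have hPd : ∀ i, (P i).natDegree = p.natDegree := fun i => hP i ▸ hp.natDegree_map _
  have hp0 : p.natDegree ≠ 0 := fun h0 => by
    rw [hp.natDegree_eq_zero.1 h0] at h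
    simp at h
  have hfac : ∀ i, ∃ a b : F[X][X], a.Monic ∧ b.Monic ∧
      (¬ Irreducible (P i) → a * b = P i ∧ a.natDegree ≠ 0 ∧ b.natDegree ≠ 0) := by
    intro i
    by_cases hi : Irreducible (P i)
    · exact ⟨1, 1, monic_one, monic_one, fun h => absurd hi h⟩
    · have := hi
      rw [(hPm i).irreducible_iff_natDegree] at this
      push Not at this
      obtain ⟨a, b, ha, hb, hab, ha0, hb0⟩ := this fun h1 => hp0 (by rw [← hPd i, h1, natDegree_one])
      exact ⟨a, b, ha, hb, fun _ => ⟨hab, ha0, hb0⟩⟩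
  choose a b ha hb hab using hfac
  set d := (Bivariate.swap p).natDegree
  have hPs : ∀ i, (Bivariate.swap (P i)).natDegree ≤ d := by
    intro i
    rw [natDegree_swap_le_iff]
    intro j
    rw [hP i, coeff_map, coe_mapRingHom]
    exact natDegree_map_le.trans ((natDegree_swap_le_iff p d).1 le_rfl j)
  classical
  set a' : ℕ → F[X][X] := fun i => if Irreducible (P i) then 1 else a i with ha'
  set b' : ℕ → F[X][X] := fun i => if Irreducible (P i) then 1 else b i with hb'
  have ha1 : ∀ i, ¬ Irreducible (P i) → a' i = a i := fun i hi => if_neg hi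
  have hb1 : ∀ i, ¬ Irreducible (P i) → b' i = b i := fun i hi => if_neg hi
  have hbound : ∀ i, ((a' i).natDegree ≤ p.natDegree ∧ (b' i).natDegree ≤ p.natDegree) ∧
      (∀ j, ((a' i).coeff j).natDegree ≤ d) ∧ ∀ j, ((b' i).coeff j).natDegree ≤ d := by
    intro i
    by_cases hi : Irreducible (P i)
    · simp only [ha', hb', hi, if_true, natDegree_one, coeff_one]
      refine ⟨⟨Nat.zero_le _, Nat.zero_le _⟩, fun j => ?_, fun j => ?_⟩ <;> split_ifs <;> simp
    · simp only [ha', hb', hi, if_false]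
      have h1 := (ha i).natDegree_mul (hb i)
      rw [(hab i hi).1, hPd i] at h1
      have h2 : (Bivariate.swap (a i)).natDegree + (Bivariate.swap (b i)).natDegree ≤ d := by
        rw [← natDegree_mul, ← map_mul, (hab i hi).1]
        · exact hPs i
        · simpa using (ha i).ne_zero
        · simpa using (hb i).ne_zero
      refine ⟨⟨by omega, by omega⟩, (natDegree_swap_le_iff _ _).1 (by omega), (natDegree_swap_le_iff _ _).1 (by omega)⟩
  obtain ⟨A, hA⟩ := exists_map_mapRingHom_evalRingHom_eq a' _ _ (fun i => (hbound i).1.1) fun i => (hbound i).2.1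
  obtain ⟨B, hB⟩ := exists_map_mapRingHom_evalRingHom_eq b' _ _ (fun i => (hbound i).1.2) fun i => (hbound i).2.2
  have hAB : A.map (mapRingHom (mk F)) * B.map (mapRingHom (mk F)) = p.map (mapRingHom (mk F)) := by
    rw [← sub_eq_zero, ← Polynomial.map_mul, ← Polynomial.map_sub, map_mapRingHom_mk_eq_zero_iff]
    filter_upwards [hcon] with i hi
    rw [Polynomial.map_sub, Polynomial.map_mul, hA, hB, sub_eq_zero, ← hP i, ha1 i hi, hb1 i hi]
    exact (hab i hi).1
  have hunit : ∀ (a'' : ℕ → F[X][X]) (A : (ℕ → F)[X][X]), (∀ i, A.map (mapRingHom (proj F i)) = a'' i) →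
      (∀ᶠ i in μ, (a'' i).natDegree ≠ 0 ∧ (a'' i).Monic) → ¬ IsUnit (A.map (mapRingHom (mk F))) := by
    intro a'' A hA ha hu
    obtain ⟨u, -, hu⟩ := isUnit_iff.1 hu
    have h1 : (A - C (A.coeff 0)).map (mapRingHom (mk F)) = 0 := by
      rw [Polynomial.map_sub, map_C, ← coeff_map, ← hu, coeff_C_zero, sub_self]
    rw [map_mapRingHom_mk_eq_zero_iff] at h1
    obtain ⟨i, h1, h2, -⟩ := (h1.and ha).exists
    rw [Polynomial.map_sub, map_C, hA, sub_eq_zero] at h1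
    rw [h1] at h2
    exact h2 (natDegree_C _)
  rcases h.isUnit_or_isUnit hAB.symm with hu | hu
  · refine hunit a' A hA ?_ hu
    filter_upwards [hcon] with i hi
    rw [ha1 i hi]
    exact ⟨(hab i hi).2.1, ha i⟩
  · refine hunit b' B hB ?_ hu
    filter_upwards [hcon] with i hi
    rw [hb1 i hi]
    exact ⟨(hab i hi).2.2, hb i⟩

end Ultrapower

namespace Ultrapower

variable {F Ω : Type*} [Field F] [Field Ω]

theorem map_ev_mk (ι : F →+* Ω) (t y : ℕ → Ω) (p : (ℕ → F)[X][X]) :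
    ev (map ι) (mk Ω t) (mk Ω y) (p.map (mapRingHom (mk F))) =
      mk Ω fun i => ev ι (t i) (y i) (p.map (mapRingHom (proj F i))) := by
  let ιn : (ℕ → F) →+* (ℕ → Ω) := RingHom.pi fun i => ι.comp (proj F i)
  have h1 : ev (map ι) (mk Ω t) (mk Ω y) (p.map (mapRingHom (mk F))) = mk Ω (ev ιn t y p) := by
    rw [map_ev, ev_map]; rfl
  rw [h1]
  congr 1
  ext i
  rw [ev_map]
  exact map_ev (proj Ω i) ιn t y p

theorem map_eval₂_mk (ι : F →+* Ω) (t : ℕ → Ω) (p : (ℕ → F)[X]) :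
    (p.map (mk F)).eval₂ (map ι) (mk Ω t) = mk Ω fun i => (p.map (proj F i)).eval₂ ι (t i) := by
  let ιn : (ℕ → F) →+* (ℕ → Ω) := RingHom.pi fun i => ι.comp (proj F i)
  rw [eval₂_map, show (map ι).comp (mk F) = (mk Ω).comp ιn from rfl, ← hom_eval₂]
  congr 1
  ext i
  rw [eval₂_map]
  exact hom_eval₂ p ιn (proj Ω i) t

theorem exists_monic_lift (p : (Ultrapower F)[X][X]) (hp : p.Monic) :
    ∃ p' : (ℕ → F)[X][X], p'.map (mapRingHom (mk F)) = p ∧ p'.Monic ∧ p'.natDegree = p.natDegree := by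
  obtain ⟨p', h1, h2, h3⟩ := lifts_and_natDegree_eq_and_monic
    ((mem_lifts p).2 (map_surjective (mapRingHom (mk F)) (map_surjective (mk F) mk_surjective) p)) hp
  exact ⟨p', h1, h3, h2⟩

end Ultrapower

open Ultrapower in
theorem HasSpecializations.ultrapower {F Ω : Type*} [Field F] [Field Ω] {ι : F →+* Ω} {N : F → Prop}
    (H : HasSpecializations ι N) : HasSpecializations (Ultrapower.map ι) (Almost N) := by
  intro q f g r h D lam hadm
  obtain ⟨q', rfl, hqm, hqd⟩ := exists_monic_lift q hadm.monic
  obtain ⟨f', rfl, hfm, -⟩ := exists_monic_lift f hadm.monic_avoid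
  obtain ⟨g', rfl⟩ := map_surjective _ mk_surjective g
  choose h' hh' hhm hhd using fun l => exists_monic_lift (h l) (hadm.monic_cover l)
  choose D' hD' using fun l => map_surjective _ mk_surjective (D l)
  choose lam' hl' using fun l => map_surjective _ mk_surjective (lam l)
  obtain rfl : (fun l => (h' l).map (mapRingHom (mk F))) = h := funext hh'
  obtain rfl : (fun l => (D' l).map (mk F)) = D := funext hD'
  obtain rfl : (fun l => (lam' l).map (mk F)) = lam := funext hl'
  have hirr : ∀ᶠ i in μ, Irreducible ((q'.map (mapRingHom (proj F i))).map (mapRingHom ι)) := by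
    let ιn : (ℕ → F) →+* (ℕ → Ω) := RingHom.pi fun i => ι.comp (proj F i)
    have h1 : (q'.map (mapRingHom ιn)).map (mapRingHom (mk Ω)) =
        (q'.map (mapRingHom (mk F))).map (mapRingHom (Ultrapower.map ι)) := by
      rw [Polynomial.map_map, Polynomial.map_map, mapRingHom_comp, mapRingHom_comp]; rfl
    filter_upwards [eventually_irreducible (q'.map (mapRingHom ιn)) (hqm.map _) (h1 ▸ hadm.irreducible)] with i hi
    rw [Polynomial.map_map, mapRingHom_comp] at hi ⊢
    exact hi
  have hg : ∀ᶠ i in μ, g'.map (proj F i) ≠ 0 := by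
    rw [Ultrafilter.eventually_not, ← map_mk_eq_zero_iff]
    exact hadm.ne_zero
  have hcirr : ∀ᶠ i in μ, ∀ l, Irreducible ((h' l).map (mapRingHom (proj F i))) :=
    Filter.eventually_all.2 fun l => eventually_irreducible _ (hhm l) (hadm.irreducible_cover l)
  have hcover : ∀ᶠ i in μ, ∀ t y w : Ω, ev ι t y (q'.map (mapRingHom (proj F i))) = 0 →
      ev ι t w (f'.map (mapRingHom (proj F i))) = 0 →
      ∃ l, ev ι t (((D' l).map (proj F i)).eval₂ ι t * w + ((lam' l).map (proj F i)).eval₂ ι t * y)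
        ((h' l).map (mapRingHom (proj F i))) = 0 := by
    by_contra hcon
    rw [← Ultrafilter.eventually_not] at hcon
    have : ∀ i, ∃ t y w : Ω, (¬ ∀ t y w : Ω, ev ι t y (q'.map (mapRingHom (proj F i))) = 0 →
      ev ι t w (f'.map (mapRingHom (proj F i))) = 0 →
      ∃ l, ev ι t (((D' l).map (proj F i)).eval₂ ι t * w + ((lam' l).map (proj F i)).eval₂ ι t * y)
        ((h' l).map (mapRingHom (proj F i))) = 0) → ev ι t y (q'.map (mapRingHom (proj F i))) = 0 ∧
      ev ι t w (f'.map (mapRingHom (proj F i))) = 0 ∧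
      ∀ l, ev ι t (((D' l).map (proj F i)).eval₂ ι t * w + ((lam' l).map (proj F i)).eval₂ ι t * y)
        ((h' l).map (mapRingHom (proj F i))) ≠ 0 := by
      intro i
      by_cases hi : ∀ t y w : Ω, ev ι t y (q'.map (mapRingHom (proj F i))) = 0 →
        ev ι t w (f'.map (mapRingHom (proj F i))) = 0 →
        ∃ l, ev ι t (((D' l).map (proj F i)).eval₂ ι t * w + ((lam' l).map (proj F i)).eval₂ ι t * y)
        ((h' l).map (mapRingHom (proj F i))) = 0
      · exact ⟨0, 0, 0, fun h => absurd hi h⟩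
      · have := hi
        push Not at this
        obtain ⟨t, y, w, h1, h2, h3⟩ := this
        exact ⟨t, y, w, fun _ => ⟨h1, h2, h3⟩⟩
    choose t y w htyw using this
    obtain ⟨l, hl⟩ := hadm.cover (mk Ω t) (mk Ω y) (mk Ω w)
      (by rw [map_ev_mk, mk_eq_zero]; filter_upwards [hcon] with i hi using (htyw i hi).1)
      (by rw [map_ev_mk, mk_eq_zero]; filter_upwards [hcon] with i hi using (htyw i hi).2.1)
    rw [map_eval₂_mk, map_eval₂_mk, ← map_mul, ← map_mul, ← map_add, map_ev_mk, mk_eq_zero] at hl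
    obtain ⟨i, h1, h2⟩ := (hl.and hcon).exists
    exact (htyw i h2).2.2 l h1
  have hsol : ∀ᶠ i in μ, ∃ t y : F, N t ∧ (g'.map (proj F i)).eval t ≠ 0 ∧
      ev (RingHom.id F) t y (q'.map (mapRingHom (proj F i))) = 0 ∧
      ∀ x, ev (RingHom.id F) t x (f'.map (mapRingHom (proj F i))) ≠ 0 := by
    filter_upwards [hirr, hg, hcirr, hcover] with i h1 h2 h3 h4
    refine H (h := fun l => (h' l).map (mapRingHom (proj F i))) (D := fun l => (D' l).map (proj F i))
      (lam := fun l => (lam' l).map (proj F i)) ⟨hqm.map _, h1, hfm.map _, h2, fun l => (hhm l).map _, h3,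
        fun l => ?_, h4⟩
    rw [hqm.natDegree_map, (hhm l).natDegree_map, hqd, hhd l]
    exact hadm.natDegree_lt l
  obtain ⟨t, ht⟩ := hsol.choice
  obtain ⟨y, hy⟩ := ht.choice
  refine ⟨mk F t, mk F y, almost_mk.2 ?_, ?_, ?_, fun x => ?_⟩
  · filter_upwards [hy] with i hi using hi.1
  · rw [mk_eval, Ne, mk_eq_zero, ← Ultrafilter.eventually_not]
    filter_upwards [hy] with i hi using hi.2.1
  · rw [mk_ev, mk_eq_zero]
    filter_upwards [hy] with i hi using hi.2.2.1
  · obtain ⟨x, rfl⟩ := mk_surjective x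
    rw [mk_ev, Ne, mk_eq_zero, ← Ultrafilter.eventually_not]
    filter_upwards [hy] with i hi using hi.2.2.2 _

namespace Ultrapower

variable {F : Type*}

/-- Countable saturation. -/
theorem exists_forall_eventually_mem [Nonempty F] (S : ℕ → ℕ → Set F)
    (h : ∀ n, ∀ᶠ i in μ, ∃ x, ∀ k ≤ n, x ∈ S k i) : ∃ x : ℕ → F, ∀ k, ∀ᶠ i in μ, x i ∈ S k i := by
  classical
  have key : ∀ i, ∃ x : F, ∀ n ≤ i, (∃ y, ∀ k ≤ n, y ∈ S k i) → ∀ k ≤ n, x ∈ S k i := by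
    intro i
    let s := (Finset.range (i + 1)).filter fun n => ∃ y, ∀ k ≤ n, y ∈ S k i
    rcases s.eq_empty_or_nonempty with hs | hs
    · refine ⟨Classical.arbitrary F, fun n hn hy => ?_⟩
      have : n ∈ s := Finset.mem_filter.2 ⟨Finset.mem_range.2 (by omega), hy⟩
      simp [hs] at this
    · obtain ⟨x, hx⟩ := (Finset.mem_filter.1 (s.max'_mem hs)).2
      refine ⟨x, fun n hn hy k hk => hx k (hk.trans ?_)⟩
      exact s.le_max' n (Finset.mem_filter.2 ⟨Finset.mem_range.2 (by omega), hy⟩)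
  choose x hx using key
  refine ⟨x, fun k => ?_⟩
  have hk : ∀ᶠ i in μ, k ≤ i := by
    have h1 : ∀ᶠ i in Filter.cofinite, k ≤ i := by
      rw [Nat.cofinite_eq_atTop]; exact Filter.eventually_ge_atTop k
    exact h1.filter_mono Filter.hyperfilter_le_cofinite
  filter_upwards [h k, hk] with i h1 h2 using hx i k h2 h1 k le_rfl

end Ultrapower

/-- The image of `σ` is relatively algebraically closed. -/
def RelAlgClosed {E M : Type*} [Field E] [Field M] (σ : E →+* M) : Prop :=
  ∀ p : E[X], p ≠ 0 → ∀ x, p.eval₂ σ x = 0 → x ∈ σ.range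

/-- `z` is transcendental over the image of `σ`. -/
def TranscendentalOver {E M : Type*} [Field E] [Field M] (σ : E →+* M) (z : M) : Prop :=
  ∀ p : E[X], p.eval₂ σ z = 0 → p = 0

theorem RelAlgClosed.transcendentalOver {E M : Type*} [Field E] [Field M] {σ : E →+* M} (hσ : RelAlgClosed σ)
    {z : M} (hz : z ∉ σ.range) : TranscendentalOver σ z := fun p hp => by
  by_contra h
  exact hz (hσ p h z hp)

theorem relAlgClosed_of_isAlgClosed {E M : Type*} [Field E] [IsAlgClosed E] [Field M] (σ : E →+* M) :
    RelAlgClosed σ := by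
  intro p hp x hx
  exact (IsAlgClosed.splits p).mem_range_of_isRoot hp (by rwa [IsRoot, eval_map])

theorem TranscendentalOver.dvd_of_ev_eq_zero {K L : Type*} [Field K] [Field L] {τ : K →+* L} {z : L}
    (hz : TranscendentalOver τ z) {y : L} {u p : K[X][X]} (hu : u.Monic) (hirr : Irreducible u)
    (huy : ev τ z y u = 0) (hp : ev τ z y p = 0) : u ∣ p := by
  let := (eval₂RingHom τ z).toAlgebra
  have hinj : Function.Injective (algebraMap K[X] L) := (injective_iff_map_eq_zero _).2 fun a ha => hz a ha
  have : Module.IsTorsionFree K[X] L := Module.isTorsionFree_iff_algebraMap_injective.2 hinj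
  have hint : IsIntegral K[X] y := ⟨u, hu, huy⟩
  have h1 : minpoly K[X] y ∣ u := minpoly.isIntegrallyClosed_dvd hint huy
  exact ((minpoly.irreducible hint).associated_of_dvd hirr h1).symm.dvd.trans (minpoly.isIntegrallyClosed_dvd hint hp)

theorem TranscendentalOver.exists_irreducible {K L : Type*} [Field K] [Field L] {τ : K →+* L} {z : L}
    (hz : TranscendentalOver τ z) {y : L} {p : K[X][X]} (hp : p.Monic) (hpy : ev τ z y p = 0) :
    ∃ u : K[X][X], u.Monic ∧ Irreducible u ∧ u ∣ p ∧ ev τ z y u = 0 := by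
  let := (eval₂RingHom τ z).toAlgebra
  have hinj : Function.Injective (algebraMap K[X] L) := (injective_iff_map_eq_zero _).2 fun a ha => hz a ha
  have : Module.IsTorsionFree K[X] L := Module.isTorsionFree_iff_algebraMap_injective.2 hinj
  have hint : IsIntegral K[X] y := ⟨p, hp, hpy⟩
  exact ⟨minpoly K[X] y, minpoly.monic hint, minpoly.irreducible hint, minpoly.isIntegrallyClosed_dvd hint hpy,
    minpoly.aeval K[X] y⟩

theorem mem_lifts_of_eval_mem_range {E M : Type*} [Field E] [Infinite E] [Field M] (σ : E →+* M) (c : M[X])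
    (h : ∀ t, c.eval (σ t) ∈ σ.range) : c ∈ lifts σ := by
  classical
  choose r hr using h
  obtain ⟨s, hs⟩ := Infinite.exists_subset_card_eq E (c.natDegree + 1)
  refine (mem_lifts _).2 ⟨Lagrange.interpolate s id r, ?_⟩
  refine Polynomial.eq_of_degrees_lt_of_eval_index_eq (v := σ) s σ.injective.injOn ?_ ?_ ?_
  · exact (degree_map_le).trans_lt (Lagrange.degree_interpolate_lt _ Function.injective_id.injOn)
  · rw [hs]
    exact degree_le_natDegree.trans_lt (by exact_mod_cast Nat.lt_succ_self _)
  · intro i hi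
    rw [eval_map, eval₂_at_apply, ← hr i]
    exact congrArg σ (Lagrange.eval_interpolate_at_node (v := id) r Function.injective_id.injOn hi)

theorem RelAlgClosed.mem_lifts_of_dvd {E M : Type*} [Field E] [Field M] {σ : E →+* M} (hσ : RelAlgClosed σ)
    {f : E[X]} (hf : f.Monic) {g : M[X]} (hg : g.Monic) (h : g ∣ f.map σ) : g ∈ lifts σ := by
  let := σ.toAlgebra
  obtain ⟨g', rfl⟩ := (mem_lifts _).1 (integralClosure.mem_lifts_of_monic_of_dvd_map M hf hg h)
  refine (lifts_iff_coeff_lifts _).2 fun j => ?_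
  rw [coeff_map]
  obtain ⟨p, hp, hp'⟩ := (g'.coeff j).2
  exact hσ p hp.ne_zero _ hp'

theorem RelAlgClosed.irreducible_map {E M : Type*} [Field E] [Infinite E] [Field M] {σ : E →+* M} (hσ : RelAlgClosed σ)
    {f : E[X][X]} (hf : f.Monic) (hirr : Irreducible f) : Irreducible (f.map (mapRingHom σ)) := by
  have hlift : ∀ u v : M[X][X], u.Monic → v.Monic → u * v = f.map (mapRingHom σ) → u ∈ lifts (mapRingHom σ) := by
    intro u v hu hv huv
    refine (lifts_iff_coeff_lifts _).2 fun j => ?_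
    refine (mem_lifts _).1 (mem_lifts_of_eval_mem_range σ _ fun t => ?_)
    have h1 : u.map (evalRingHom (σ t)) ∣ (f.map (evalRingHom t)).map σ := by
      refine ⟨v.map (evalRingHom (σ t)), ?_⟩
      rw [← Polynomial.map_mul, huv, Polynomial.map_map, Polynomial.map_map]
      congr 1
      ext <;> simp
    have h2 := (lifts_iff_coeff_lifts _).1 (hσ.mem_lifts_of_dvd (hf.map _) (hu.map _) h1) j
    rwa [coeff_map] at h2
  have hm : (f.map (mapRingHom σ)).Monic := hf.map _
  rw [hm.irreducible_iff_natDegree]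
  refine ⟨fun h1 => hirr.not_isUnit ?_, fun u v hu hv huv => ?_⟩
  · have := congrArg natDegree h1
    rw [hf.natDegree_map, natDegree_one] at this
    rw [hf.natDegree_eq_zero.1 this]
    exact isUnit_one
  · obtain ⟨u', rfl⟩ := (mem_lifts _).1 (hlift _ _ hu hv huv)
    obtain ⟨v', rfl⟩ := (mem_lifts _).1 (hlift _ _ hv hu (by rw [mul_comm, huv]))
    have hinj : Function.Injective (mapRingHom σ) := map_injective σ σ.injective
    rw [← Polynomial.map_mul] at huv
    have h1 := map_injective _ hinj huv
    have hu' : u'.Monic := monic_of_injective hinj hu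
    have hv' : v'.Monic := monic_of_injective hinj hv
    rw [hu'.natDegree_map, hv'.natDegree_map]
    exact (hf.irreducible_iff_natDegree.1 hirr).2 u' v' hu' hv' h1

theorem irreducible_map_algebraicClosure {E G Ω : Type*} [Field E] [CharZero E] [Field G] [Algebra E G] [Field Ω]
    [Algebra G Ω] [Algebra E Ω] [IsScalarTower E G Ω] [IsAlgClosure G Ω]
    (hE : RelAlgClosed (algebraMap E G)) {z y : G} (hz : TranscendentalOver (algebraMap E G) z)
    {q : E[X][X]} (hq : q.Monic) (hirr : Irreducible q) (hqy : ev (algebraMap E G) z y q = 0) :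
    Irreducible (q.map (mapRingHom (algebraMap E (algebraicClosure E Ω)))) := by
  set k := algebraicClosure E Ω
  have : IsAlgClosed Ω := IsAlgClosure.isAlgClosed G
  have : CharZero G := charZero_of_injective_algebraMap (algebraMap E G).injective
  have hz' : TranscendentalOver (algebraMap k Ω) (algebraMap G Ω z) := by
    have h1 : Transcendental E (algebraMap G Ω z) := by
      rw [transcendental_iff]
      intro p hp
      refine hz p ((algebraMap G Ω).injective ?_)
      rw [hom_eval₂, map_zero, ← hp, aeval_def, IsScalarTower.algebraMap_eq E G Ω]
    intro p hp
    exact transcendental_iff.1 h1.algebraicClosure p hp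
  have hqk : ev (algebraMap k Ω) (algebraMap G Ω z) (algebraMap G Ω y) (q.map (mapRingHom (algebraMap E k))) = 0 := by
    rw [ev_map, ← IsScalarTower.algebraMap_eq E k Ω, IsScalarTower.algebraMap_eq E G Ω, ← map_ev, hqy, map_zero]
  obtain ⟨u, hu, huirr, hudvd, huy⟩ := hz'.exists_irreducible (hq.map _) hqk
  have hfix : ∀ (s : Ω ≃ₐ[G] Ω) (j l : ℕ), s ((u.coeff j).coeff l : k) = ((u.coeff j).coeff l : k) := by
    intro s
    let s' : Ω →ₐ[E] Ω := (s : Ω →ₐ[G] Ω).restrictScalars E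
    have hs' : ∀ x : k, s' x ∈ k := fun x => (map_mem_algebraicClosure_iff s').2 x.2
    let φ : k →+* k := (s'.toRingHom.comp (algebraMap k Ω)).codRestrict k hs'
    have h1 : ev (algebraMap k Ω) (algebraMap G Ω z) (algebraMap G Ω y) (u.map (mapRingHom φ)) = 0 := by
      rw [ev_map]
      have h2 := map_ev s'.toRingHom (algebraMap k Ω) (algebraMap G Ω z) (algebraMap G Ω y) u
      rw [huy, map_zero] at h2
      have h3 : ∀ x, s'.toRingHom (algebraMap G Ω x) = algebraMap G Ω x := fun x => s.commutes x
      rw [h3, h3] at h2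
      exact h2.symm
    have h2 := eq_of_monic_of_dvd_of_natDegree_le hu (hu.map _) (hz'.dvd_of_ev_eq_zero hu huirr huy h1)
      (hu.natDegree_map (mapRingHom φ)).le
    intro j l
    have h3 := congrArg (fun p => ((p.coeff j).coeff l : Ω)) h2
    simp only [coeff_map, coe_mapRingHom] at h3
    exact h3
  have hcoeff : ∀ j l, (u.coeff j).coeff l ∈ (algebraMap E k).range := by
    intro j l
    obtain ⟨c, hc⟩ := (InfiniteGalois.mem_range_algebraMap_iff_fixed (k := G) _).2 fun s => hfix s j l
    obtain ⟨p, hp, hp'⟩ := ((u.coeff j).coeff l).2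
    obtain ⟨e, rfl⟩ := hE p hp.ne_zero c ((algebraMap G Ω).injective (by
      rw [hom_eval₂, map_zero, hc, ← IsScalarTower.algebraMap_eq E G Ω]; exact hp'))
    refine ⟨e, Subtype.ext ?_⟩
    rw [← hc, ← IsScalarTower.algebraMap_apply]
    rfl
  obtain ⟨u', rfl⟩ := (mem_lifts _).1 ((lifts_iff_coeff_lifts (f := mapRingHom (algebraMap E k)) u).2 fun j =>
    (mem_lifts _).1 ((lifts_iff_coeff_lifts (f := algebraMap E k) (u.coeff j)).2 fun l => hcoeff j l))
  have hinj : Function.Injective (mapRingHom (algebraMap E k)) := map_injective _ (algebraMap E k).injective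
  have hu' : u'.Monic := monic_of_injective hinj hu
  have h1 : u' ∣ q := (map_dvd_map _ hinj hu').1 hudvd
  have h2 : Associated u' q := by
    obtain ⟨v, hv⟩ := h1
    rcases hirr.isUnit_or_isUnit hv with h | h
    · exact absurd (h.map (mapRingHom (mapRingHom (algebraMap E k)))) huirr.not_isUnit
    · exact ⟨h.unit, hv.symm⟩
  rwa [← eq_of_monic_of_associated hu' hq h2]

theorem RelAlgClosed.irreducible_map_of_ev_eq_zero {E G M : Type*} [Field E] [CharZero E] [Field G] [Field M]
    {σ : E →+* G} (hσ : RelAlgClosed σ) {z y : G} (hz : TranscendentalOver σ z) {q : E[X][X]} (hq : q.Monic)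
    (hirr : Irreducible q) (hqy : ev σ z y q = 0) (τ : E →+* M) : Irreducible (q.map (mapRingHom τ)) := by
  let := σ.toAlgebra
  let Ω := AlgebraicClosure G
  have h1 := irreducible_map_algebraicClosure (Ω := Ω) hσ hz hq hirr hqy
  let N := AlgebraicClosure M
  let := ((algebraMap M N).comp τ).toAlgebra
  have : IsAlgClosure E (algebraicClosure E Ω) := inferInstance
  have : IsAlgClosed (algebraicClosure E Ω) := IsAlgClosure.isAlgClosed E
  let j : algebraicClosure E Ω →ₐ[E] N := IsAlgClosed.lift
  have : CharZero (algebraicClosure E Ω) := charZero_of_injective_algebraMap (algebraMap E _).injective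
  have h2 := (relAlgClosed_of_isAlgClosed j.toRingHom).irreducible_map (hq.map _) h1
  refine irreducible_of_irreducible_map_mapRingHom (algebraMap M N) (hq.map _) ?_
  rw [Polynomial.map_map, mapRingHom_comp] at h2 ⊢
  rwa [show j.toRingHom.comp (algebraMap E _) = (algebraMap M N).comp τ from j.comp_algebraMap] at h2

open IntermediateField in
theorem exists_integral_generator {R k G : Type*} [CommRing R] [IsDomain R] [Field k] [CharZero k] [Algebra R k]
    [IsFractionRing R k] [Field G] [Algebra R G] [Algebra k G] [IsScalarTower R k G] (S : Finset G)
    (hS : ∀ ρ ∈ S, IsIntegral R ρ) :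
    ∃ y : G, IsIntegral R y ∧ ∀ ρ ∈ S, ∃ D : R, D ≠ 0 ∧ ∃ r : R[X], D • ρ = aeval y r := by
  classical
  have : FiniteDimensional k (adjoin k (S : Set G)) :=
    finiteDimensional_adjoin fun x hx => (hS x hx).tower_top
  obtain ⟨α, hα⟩ := Field.exists_primitive_element k (adjoin k (S : Set G))
  have hαk : IsIntegral k (α : G) := by
    have := (IsIntegral.of_finite k α).map (val _ : _ →ₐ[k] G)
    exact this
  have hSα : ∀ ρ ∈ S, ρ ∈ k⟮(α : G)⟯ := by
    intro ρ hρ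
    have h1 : (⟨ρ, subset_adjoin k _ hρ⟩ : adjoin k (S : Set G)) ∈ k⟮α⟯ := by rw [hα]; trivial
    have h2 : (k⟮α⟯).map (val (adjoin k (S : Set G))) = k⟮(α : G)⟯ := by
      rw [adjoin_map, Set.image_singleton]; rfl
    rw [← h2]
    exact ⟨_, h1, rfl⟩
  have hαR : IsAlgebraic R (α : G) := (IsFractionRing.isAlgebraic_iff R k G).2 hαk.isAlgebraic
  obtain ⟨d, hd, hdα⟩ := hαR.exists_integral_multiple
  refine ⟨d • (α : G), hdα, fun ρ hρ => ?_⟩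
  have hdk : algebraMap R k d ≠ 0 := by simpa using hd
  have h1 : ρ ∈ k⟮d • (α : G)⟯ := by
    have h2 : k⟮(α : G)⟯ ≤ k⟮d • (α : G)⟯ := by
      rw [adjoin_simple_le_iff]
      have h3 : (α : G) = (algebraMap R k d)⁻¹ • (d • (α : G)) := by
        rw [← algebraMap_smul k d (α : G), smul_smul, inv_mul_cancel₀ hdk, one_smul]
      have h4 := IntermediateField.smul_mem k⟮d • (α : G)⟯ (x := (algebraMap R k d)⁻¹)
        (mem_adjoin_simple_self k (d • (α : G)))
      rwa [← h3] at h4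
    exact h2 (hSα ρ hρ)
  rw [← mem_toSubalgebra, adjoin_simple_toSubalgebra_of_isAlgebraic (hdα.tower_top (A := k)).isAlgebraic,
    Algebra.adjoin_singleton_eq_range_aeval] at h1
  obtain ⟨p, hp⟩ := h1
  obtain ⟨b, hb, hbp⟩ := IsLocalization.integerNormalization_spec (nonZeroDivisors R) p
  refine ⟨b, nonZeroDivisors.ne_zero hb, IsLocalization.integerNormalization (nonZeroDivisors R) p, ?_⟩
  rw [← aeval_map_algebraMap k, hbp, ← hp, ← algebraMap_smul k b p, map_smul, algebraMap_smul]
  rfl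

open IntermediateField in
theorem exists_natDegree_minpoly_lt {R k G : Type*} [CommRing R] [IsDomain R] [IsIntegrallyClosed R] [Field k]
    [CharZero k] [Algebra R k]
    [IsFractionRing R k] [Field G] [Algebra R G] [Algebra k G] [IsScalarTower R k G] {y ρ : G} (hy : IsIntegral R y)
    (hρ : IsIntegral R ρ) (h : ρ ∉ k⟮y⟯) :
    ∃ c : ℕ, (minpoly R y).natDegree < (minpoly R (ρ + c * y)).natDegree := by
  have hint : ∀ c : ℕ, IsIntegral R (ρ + c * y) := fun c => hρ.add ((isIntegral_natCast c).mul hy)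
  have hdeg : ∀ x : G, IsIntegral R x → (minpoly R x).natDegree = Module.finrank k k⟮x⟯ := by
    intro x hx
    rw [adjoin.finrank (hx.tower_top (A := k)), minpoly.isIntegrallyClosed_eq_field_fractions' k hx,
      (minpoly.monic hx).natDegree_map]
  let M := adjoin k ({y, ρ} : Set G)
  have hfin : FiniteDimensional k M := finiteDimensional_adjoin fun x hx => by
    rcases hx with rfl | rfl
    exacts [hy.tower_top, hρ.tower_top]
  have hfinI : Finite (IntermediateField k M) :=
    Field.finite_intermediateField_of_exists_primitive_element k M (Field.exists_primitive_element k M)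
  have hyM : y ∈ M := subset_adjoin k _ (by simp)
  have hρM : ρ ∈ M := subset_adjoin k _ (by simp)
  obtain ⟨c, c', hcc, heq⟩ := Finite.exists_ne_map_eq_of_infinite
    fun c : ℕ => k⟮((⟨ρ, hρM⟩ : M) + (c : M) * ⟨y, hyM⟩)⟯
  refine ⟨c, ?_⟩
  have hmem : y ∈ k⟮ρ + c * y⟯ ∧ ρ ∈ k⟮ρ + c * y⟯ := by
    have h0 : k⟮ρ + c * y⟯ = k⟮ρ + c' * y⟯ := by
      have := congrArg (IntermediateField.map (val M)) heq
      simp only [adjoin_map, Set.image_singleton] at this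
      exact this
    have h1 : ρ + c * y ∈ k⟮ρ + c * y⟯ := mem_adjoin_simple_self k _
    have h2 : ρ + c' * y ∈ k⟮ρ + c * y⟯ := h0 ▸ mem_adjoin_simple_self k (ρ + c' * y)
    have : CharZero G := charZero_of_injective_algebraMap (algebraMap k G).injective
    have h3 : y ∈ k⟮ρ + c * y⟯ := by
      have h4 : y = ((c : G) - c')⁻¹ * ((ρ + c * y) - (ρ + c' * y)) := by
        have : (c : G) - c' ≠ 0 := sub_ne_zero.2 (by exact_mod_cast hcc)
        field_simp
        ring
      have h5 := mul_mem (inv_mem (sub_mem (_root_.natCast_mem k⟮ρ + c * y⟯ c)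
        (_root_.natCast_mem k⟮ρ + c * y⟯ c'))) (sub_mem h1 h2)
      rwa [← h4] at h5
    refine ⟨h3, ?_⟩
    have h5 := sub_mem h1 (mul_mem (_root_.natCast_mem k⟮ρ + c * y⟯ c) h3)
    rwa [add_sub_cancel_right] at h5
  rw [hdeg y hy, hdeg _ (hint c)]
  have hle : k⟮y⟯ ≤ k⟮ρ + c * y⟯ := adjoin_simple_le_iff.2 hmem.1
  have hfd : FiniteDimensional k k⟮ρ + c * y⟯ := adjoin.finiteDimensional ((hint c).tower_top)
  by_contra hcon
  push Not at hcon
  exact h ((eq_of_le_of_finrank_le hle hcon).symm ▸ hmem.2)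

theorem map_dvd_map_of_ker_le {B S S' : Type*} [CommRing B] [CommRing S] [CommRing S'] {φ : B →+* S}
    {φ' : B →+* S'} (h : ∀ b, φ b = 0 → φ' b = 0) {f H : B[X]} (hf : f.Monic) (hd : f.map φ ∣ H.map φ) :
    f.map φ' ∣ H.map φ' := by
  rw [← modByMonic_eq_zero_iff_dvd (hf.map _), ← map_modByMonic _ hf] at hd ⊢
  ext j
  have := congrArg (fun p => p.coeff j) hd
  simp only [coeff_map, coeff_zero] at this ⊢
  exact h _ this

theorem map_prod_comp {R T : Type*} [CommRing R] [CommRing T] (ψ : R[X] →+* T) {r : ℕ} (h : Fin r → R[X])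
    (c : Fin r → ℕ) : (∏ l, ((h l).map C).comp (X + C (c l * X)) : R[X][X]).map ψ =
      ∏ l, ((h l).map (ψ.comp C)).comp (X + C (c l * ψ X)) := by
  simp only [Polynomial.map_prod, Polynomial.map_comp, Polynomial.map_map, Polynomial.map_add, map_X, map_C]
  simp only [map_mul ψ, map_natCast ψ]

open IntermediateField in
theorem exists_cover {R G : Type*} [CommRing R] [IsDomain R] [IsIntegrallyClosed R] [CharZero R] [Field G]
    [Algebra R G] [FaithfulSMul R G] {y : G} (hy : IsIntegral R y) {f : R[X]} (hf : f.Monic)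
    (hfG : ∀ x : G, aeval x f ≠ 0) :
    ∃ (r : ℕ) (h : Fin r → R[X]) (c : Fin r → ℕ), (∀ l, (h l).Monic) ∧ (∀ l, Irreducible (h l)) ∧
      (∀ l, (minpoly R y).natDegree < (h l).natDegree) ∧
      ∀ {S : Type*} [CommRing S] [IsDomain S] (φ : R[X] →+* S) (w : S), φ (minpoly R y) = 0 →
        f.eval₂ (φ.comp C) w = 0 → ∃ l, (h l).eval₂ (φ.comp C) (w + c l * φ X) = 0 := by
  classical
  let k := FractionRing R
  let Ω := AlgebraicClosure G
  let := FractionRing.liftAlgebra R G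
  have : IsScalarTower R k G := inferInstance
  have : CharZero k := charZero_of_injective_algebraMap (IsFractionRing.injective R k)
  have : IsScalarTower R k Ω := IsScalarTower.of_algebraMap_eq fun x => by
    rw [IsScalarTower.algebraMap_apply R G Ω, IsScalarTower.algebraMap_apply R k G,
      ← IsScalarTower.algebraMap_apply k G Ω]
  have hyΩ : IsIntegral R (algebraMap G Ω y) := hy.algebraMap
  have hmin : minpoly R (algebraMap G Ω y) = minpoly R y :=
    minpoly.algebraMap_eq (algebraMap G Ω).injective y
  obtain ⟨L, hLprod⟩ : ∃ L : List Ω, f.map (algebraMap R Ω) = ∏ l : Fin L.length, (X - C L[l]) := by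
    refine ⟨(f.map (algebraMap R Ω)).roots.toList, ?_⟩
    refine ((IsAlgClosed.splits (f.map (algebraMap R Ω))).eq_prod_roots_of_monic (hf.map _)).trans ?_
    refine Eq.trans ?_ (Fin.prod_univ_fun_getElem _ fun x => X - C x).symm
    rw [← Multiset.prod_coe, ← Multiset.map_coe, Multiset.coe_toList]
  have hLroot : ∀ x ∈ L, aeval x f = 0 := by
    intro x hx
    obtain ⟨l, hl, rfl⟩ := List.getElem_of_mem hx
    rw [← eval_map_algebraMap, hLprod, eval_prod]
    exact Finset.prod_eq_zero (Finset.mem_univ ⟨l, hl⟩) (by simp)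
  have hLk : ∀ x ∈ L, x ∉ k⟮algebraMap G Ω y⟯ := by
    intro x hx hxy
    have h1 : k⟮algebraMap G Ω y⟯ = (k⟮y⟯).map (IsScalarTower.toAlgHom k G Ω) := by
      rw [adjoin_map, Set.image_singleton]; rfl
    rw [h1] at hxy
    obtain ⟨x, -, rfl⟩ := hxy
    refine hfG x ((algebraMap G Ω).injective ?_)
    rw [map_zero, ← hLroot _ hx]
    exact (aeval_algebraMap_apply Ω x f).symm
  have hLint : ∀ x ∈ L, IsIntegral R x := fun x hx => ⟨f, hf, hLroot x hx⟩
  choose! c hc using fun x hx => exists_natDegree_minpoly_lt (k := k) hyΩ (hLint x hx) (hLk x hx)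
  have hint : ∀ x ∈ L, IsIntegral R (x + c x * algebraMap G Ω y) := fun x hx =>
    (hLint x hx).add ((isIntegral_natCast _).mul hyΩ)
  have hmem : ∀ l : Fin L.length, L[l] ∈ L := fun l => List.getElem_mem _
  let h : Fin L.length → R[X] := fun l => minpoly R (L[l] + c L[l] * algebraMap G Ω y)
  refine ⟨L.length, h, fun l => c L[l],
    fun l => minpoly.monic (hint _ (hmem l)), fun l => minpoly.irreducible (hint _ (hmem l)),
    fun l => hmin ▸ hc _ (hmem l), ?_⟩
  intro S _ _ φ w hφ hw
  let ψ : R[X] →+* Ω := (aeval (algebraMap G Ω y) : R[X] →ₐ[R] Ω).toRingHom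
  have hψC : ψ.comp C = algebraMap R Ω := by ext x; exact aeval_C _ x
  have hψX : ψ X = algebraMap G Ω y := aeval_X _
  have hker : ∀ b, ψ b = 0 → φ b = 0 := by
    intro b hb
    have hb' : aeval y b = 0 := (algebraMap G Ω).injective (by
      rw [map_zero, ← hb]; exact (aeval_algebraMap_apply Ω y b).symm)
    obtain ⟨d, rfl⟩ := minpoly.isIntegrallyClosed_dvd hy hb'
    rw [map_mul, hφ, zero_mul]
  have hdvd : (f.map C).map ψ ∣ (∏ l, ((h l).map C).comp (X + C (c L[l] * X))).map ψ := by
    rw [map_prod_comp ψ h fun l => c L[l], Polynomial.map_map, hψC, hLprod]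
    refine Finset.prod_dvd_prod_of_dvd _ _ fun l _ => ?_
    rw [dvd_iff_isRoot, IsRoot, eval_comp, hψX, eval_add, eval_X, eval_C, eval_map_algebraMap]
    exact minpoly.aeval R (L[l] + c L[l] * algebraMap G Ω y)
  have h1 := map_dvd_map_of_ker_le hker (hf.map C) hdvd
  rw [map_prod_comp φ h fun l => c L[l], Polynomial.map_map] at h1
  have h2 := eval_dvd (x := w) h1
  rw [eval_map, hw, zero_dvd_iff, eval_prod, Finset.prod_eq_zero_iff] at h2
  obtain ⟨l, -, hl⟩ := h2
  refine ⟨l, ?_⟩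
  rw [← hl, eval_comp, eval_map]
  simp

theorem exists_common_parameter {R G : Type*} [CommRing R] [IsDomain R] [IsIntegrallyClosed R] [CharZero R] [Field G]
    [Algebra R G] [FaithfulSMul R G] (P : Finset R[X]) (hP : ∀ p ∈ P, p.Monic ∧ ∃ x : G, aeval x p = 0) :
    ∃ (y : G) (g : R), IsIntegral R y ∧ g ≠ 0 ∧ ∀ {S : Type*} [Field S] (φ : R[X] →+* S), φ (minpoly R y) = 0 →
      φ (C g) ≠ 0 → ∀ p ∈ P, ∃ x, p.eval₂ (φ.comp C) x = 0 := by
  classical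
  let k := FractionRing R
  let := FractionRing.liftAlgebra R G
  have : IsScalarTower R k G := inferInstance
  have : CharZero k := charZero_of_injective_algebraMap (IsFractionRing.injective R k)
  choose! ρ hρ using fun p hp => (hP p hp).2
  obtain ⟨y, hy, hyP⟩ := exists_integral_generator (k := k) (P.image ρ) (by
    intro x hx
    obtain ⟨p, hp, rfl⟩ := Finset.mem_image.1 hx
    exact ⟨p, (hP p hp).1, hρ p hp⟩)
  choose! D hD u hu using fun p hp => hyP (ρ p) (Finset.mem_image_of_mem ρ hp)
  refine ⟨y, ∏ p ∈ P, D p, hy, Finset.prod_ne_zero_iff.2 hD, ?_⟩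
  intro S _ φ hφ hφg p hp
  have hφD : φ (C (D p)) ≠ 0 := by
    rw [map_prod, map_prod, Finset.prod_ne_zero_iff] at hφg
    exact hφg p hp
  have h1 : φ ((scaleRoots p (D p)).eval₂ C (u p)) = 0 := by
    have h2 : aeval y ((scaleRoots p (D p)).eval₂ C (u p)) = 0 := by
      have h3 := scaleRoots_eval₂_mul (p := p) (algebraMap R G) (ρ p) (D p)
      rw [← aeval_def (ρ p), hρ p hp, mul_zero, ← Algebra.smul_def, hu p hp] at h3
      rw [← h3, ← AlgHom.coe_toRingHom, hom_eval₂]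
      congr 1
      ext x
      exact aeval_C y x
    obtain ⟨d, hd⟩ := minpoly.isIntegrallyClosed_dvd hy h2
    rw [hd, map_mul, hφ, zero_mul]
  refine ⟨(φ (C (D p)))⁻¹ * φ (u p), ?_⟩
  rw [hom_eval₂] at h1
  have h2 := scaleRoots_eval₂_mul (p := p) (φ.comp C) ((φ (C (D p)))⁻¹ * φ (u p)) (D p)
  rw [RingHom.comp_apply, mul_inv_cancel_left₀ hφD, h1] at h2
  exact (mul_eq_zero.1 h2.symm).resolve_left (pow_ne_zero _ hφD)

theorem eval₂_ev_comp_C {A B : Type*} [CommRing A] [CommRing B] (τ : A →+* B) (t y x : B) (p : A[X][X]) :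
    p.eval₂ ((ev τ t y).comp C) x = ev τ t x p := by
  have : (ev τ t y).comp C = eval₂RingHom τ t := RingHom.ext fun p => ev_C τ t y p
  rw [this]; rfl

theorem HasSpecializations.exists_realization {E G Ω : Type*} [Field E] [CharZero E] [Field G] [Field Ω]
    {ι : G →+* Ω} {N : G → Prop} (H : HasSpecializations ι N) {i σ : E →+* G} (hi : RelAlgClosed i)
    (hσ : RelAlgClosed σ) {z : G} (hz : TranscendentalOver i z) (P : Finset E[X][X])
    (hP : ∀ p ∈ P, p.Monic ∧ ∃ x, ev i z x p = 0) {f : E[X][X]} (hf : f.Monic) (hfz : ∀ x, ev i z x f ≠ 0)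
    {g : E[X]} (hg : g ≠ 0) :
    ∃ t, N t ∧ g.eval₂ σ t ≠ 0 ∧ (∀ p ∈ P, ∃ x, ev σ t x p = 0) ∧ ∀ x, ev σ t x f ≠ 0 := by
  let := (eval₂RingHom i z).toAlgebra
  have : FaithfulSMul E[X] G :=
    (faithfulSMul_iff_algebraMap_injective _ _).2 ((injective_iff_map_eq_zero _).2 fun a ha => hz a ha)
  obtain ⟨y, g', hy, hg', hpos⟩ := exists_common_parameter (G := G) P hP
  obtain ⟨r, h, c, hm, hirr, hdeg, hcov⟩ := exists_cover hy hf hfz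
  have hq : (minpoly E[X] y).Monic := minpoly.monic hy
  have hadm : Admissible ι ((minpoly E[X] y).map (mapRingHom σ)) (f.map (mapRingHom σ)) ((g * g').map σ)
      (fun l => (h l).map (mapRingHom σ)) (fun _ => 1) (fun l => (c l : G[X])) := by
    refine ⟨hq.map _, ?_, hf.map _, ?_, fun l => (hm l).map _, fun l => hσ.irreducible_map (hm l) (hirr l),
      fun l => ?_, fun t y' w hy' hw => ?_⟩
    · rw [Polynomial.map_map, mapRingHom_comp]
      exact hi.irreducible_map_of_ev_eq_zero hz hq (minpoly.irreducible hy) (minpoly.aeval _ y) _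
    · rw [Polynomial.map_ne_zero_iff σ.injective]
      exact mul_ne_zero hg hg'
    · rw [hq.natDegree_map, (hm l).natDegree_map]
      exact hdeg l
    · rw [ev_map] at hy' hw
      obtain ⟨l, hl⟩ := hcov (ev (ι.comp σ) t y') w hy' (by rwa [eval₂_ev_comp_C])
      refine ⟨l, ?_⟩
      rw [ev_map, ← hl, eval₂_ev_comp_C, ev_X]
      simp
  obtain ⟨t, y', hN, hgt, hqt, hft⟩ := H hadm
  rw [ev_map] at hqt
  simp only [ev_map] at hft
  rw [eval_map, eval₂_mul] at hgt
  refine ⟨t, hN, left_ne_zero_of_mul hgt, fun p hp => ?_, hft⟩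
  obtain ⟨x, hx⟩ := hpos (ev σ t y') hqt (by rw [ev_C]; exact right_ne_zero_of_mul hgt) p hp
  exact ⟨x, by rwa [eval₂_ev_comp_C] at hx⟩

/-- `(i, z)` and `(σ, z')` satisfy the same monic polynomial equations. -/
def SameRoots {E G : Type*} [Field E] [Field G] (i σ : E →+* G) (z z' : G) : Prop :=
  ∀ p : E[X][X], p.Monic → ((∃ x, ev i z x p = 0) ↔ ∃ x, ev σ z' x p = 0)

open Ultrapower in
theorem HasSpecializations.exists_sameRoots {E F Ω : Type*} [Field E] [CharZero E] [Countable E] [Field F] [Field Ω]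
    {ι : F →+* Ω} {N : F → Prop} (H : HasSpecializations ι N) {i σ : E →+* Ultrapower F} (hi : RelAlgClosed i)
    (hσ : RelAlgClosed σ) {z : Ultrapower F} (hz : TranscendentalOver i z) :
    ∃ z', Almost N z' ∧ TranscendentalOver σ z' ∧ SameRoots i σ z z' := by
  classical
  choose g' hg' using fun g : E[X] => map_surjective _ mk_surjective (g.map σ)
  choose p' hp' using fun p : E[X][X] =>
    map_surjective (mapRingHom (mk F)) (map_surjective (mk F) mk_surjective) (p.map (mapRingHom σ))
  let A : E[X][X] → Prop := fun p => ∃ x, ev i z x p = 0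
  let S : E[X] × E[X][X] → ℕ → Set F := fun a j => {t | N t ∧ (a.1 ≠ 0 → ((g' a.1).map (proj F j)).eval t ≠ 0) ∧
    (a.2.Monic → (A a.2 ↔ ∃ x, ev (RingHom.id F) t x ((p' a.2).map (mapRingHom (proj F j))) = 0))}
  have hS : ∀ (t : ℕ → F) (a : E[X] × E[X][X]), (∀ᶠ j in μ, t j ∈ S a j) ↔ (Almost N (mk F t) ∧
      (a.1 ≠ 0 → a.1.eval₂ σ (mk F t) ≠ 0) ∧ (a.2.Monic → (A a.2 ↔ ∃ x, ev σ (mk F t) x a.2 = 0))) := by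
    intro t a
    have h1 : a.1.eval₂ σ (mk F t) ≠ 0 ↔ ∀ᶠ j in μ, ((g' a.1).map (proj F j)).eval (t j) ≠ 0 := by
      rw [Ultrafilter.eventually_not, ← mk_eq_zero, ← mk_eval, hg', eval_map]
    have h2 : (∃ x, ev σ (mk F t) x a.2 = 0) ↔
        ∀ᶠ j in μ, ∃ x, ev (RingHom.id F) (t j) x ((p' a.2).map (mapRingHom (proj F j))) = 0 := by
      have h3 : ∀ x : ℕ → F, ev σ (mk F t) (mk F x) a.2 = 0 ↔
          ∀ᶠ j in μ, ev (RingHom.id F) (t j) (x j) ((p' a.2).map (mapRingHom (proj F j))) = 0 := by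
        intro x
        rw [← mk_eq_zero, ← mk_ev, hp', ev_map, RingHom.id_comp]
      constructor
      · rintro ⟨x, hx⟩
        obtain ⟨x, rfl⟩ := mk_surjective x
        filter_upwards [(h3 x).1 hx] with j hj using ⟨_, hj⟩
      · intro h
        obtain ⟨x, hx⟩ := h.choice
        exact ⟨mk F x, (h3 x).2 hx⟩
    have himp : ∀ (Q : Prop) (B : ℕ → Prop), (∀ᶠ j in μ, Q → B j) ↔ (Q → ∀ᶠ j in μ, B j) := fun Q B => by
      by_cases hQ : Q <;> simp [hQ]
    have hiff : ∀ (Q : Prop) (B : ℕ → Prop), (∀ᶠ j in μ, (Q ↔ B j)) ↔ (Q ↔ ∀ᶠ j in μ, B j) := fun Q B => by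
      by_cases hQ : Q <;> simp [hQ]
    simp only [S, Set.mem_ofPred_eq]
    rw [Filter.eventually_and, Filter.eventually_and, himp, himp, hiff, ← h1, ← h2, almost_mk]
  obtain ⟨e, he⟩ := exists_surjective_nat (E[X] × E[X][X])
  obtain ⟨t, ht⟩ := exists_forall_eventually_mem (fun k j => S (e k) j) (by
    intro n
    let s : Finset (E[X] × E[X][X]) := (Finset.range (n + 1)).image e
    obtain ⟨T, hTN, hTg, hTP, hTf⟩ := H.ultrapower.exists_realization hi hσ hz
      ((s.image Prod.snd).filter fun p => p.Monic ∧ A p) (fun p hp => (Finset.mem_filter.1 hp).2)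
      (f := ∏ p ∈ (s.image Prod.snd).filter fun p => p.Monic ∧ ¬ A p, p)
      (monic_prod_of_monic _ _ fun p hp => (Finset.mem_filter.1 hp).2.1)
      (fun x => by
        rw [map_prod, Finset.prod_ne_zero_iff]
        exact fun p hp h0 => (Finset.mem_filter.1 hp).2.2 ⟨x, h0⟩)
      (g := ∏ g ∈ (s.image Prod.fst).filter (· ≠ 0), g)
      (Finset.prod_ne_zero_iff.2 fun g hg => (Finset.mem_filter.1 hg).2)
    obtain ⟨t, rfl⟩ := mk_surjective T
    have : ∀ᶠ j in μ, ∀ k ∈ Finset.range (n + 1), t j ∈ S (e k) j := by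
      rw [Filter.eventually_all_finset]
      intro k hk
      have hks : e k ∈ s := Finset.mem_image_of_mem e hk
      refine (hS t (e k)).2 ⟨hTN, fun h => ?_, fun h => ⟨fun hA => ?_, fun hx => ?_⟩⟩
      · rw [eval₂_finsetProd, Finset.prod_ne_zero_iff] at hTg
        exact hTg _ (Finset.mem_filter.2 ⟨Finset.mem_image_of_mem _ hks, h⟩)
      · exact hTP _ (Finset.mem_filter.2 ⟨Finset.mem_image_of_mem _ hks, h, hA⟩)
      · by_contra hA
        obtain ⟨x, hx⟩ := hx
        have := hTf x
        rw [map_prod, Finset.prod_ne_zero_iff] at this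
        exact this _ (Finset.mem_filter.2 ⟨Finset.mem_image_of_mem _ hks, h, hA⟩) hx
    filter_upwards [this] with j hj
    exact ⟨t j, fun k hk => hj k (Finset.mem_range.2 (by omega))⟩)
  have ht' : ∀ a, _ := fun a => (hS t a).1 (by obtain ⟨k, rfl⟩ := he a; exact ht k)
  refine ⟨mk F t, (ht' 0).1, fun p hp => ?_, fun p hp => (ht' (0, p)).2.2 hp⟩
  by_contra h
  exact (ht' (p, 0)).2.1 h hp

theorem exists_monic_forall_exists_root_iff (R : Type*) {k : Type*} [CommRing R] [IsDomain R] [Field k] [Algebra R k]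
    [IsFractionRing R k] {p : k[X]} (hp : p ≠ 0) :
    ∃ q : R[X], q.Monic ∧ ∀ (L : Type u) [Field L] [Algebra k L],
      (∃ x : L, aeval x p = 0) ↔ ∃ x : L, q.eval₂ ((algebraMap k L).comp (algebraMap R k)) x = 0 := by
  let P := IsLocalization.integerNormalization (nonZeroDivisors R) p
  have hP : P ≠ 0 := fun h => hp (IsFractionRing.integerNormalization_eq_zero_iff.1 h)
  refine ⟨P.integralNormalization, monic_integralNormalization hP, fun L _ _ => ?_⟩
  obtain ⟨b, hb, hbP⟩ := IsLocalization.integerNormalization_spec (nonZeroDivisors R) p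
  let f : R →+* L := (algebraMap k L).comp (algebraMap R k)
  have hf : Function.Injective f := (algebraMap k L).injective.comp (IsFractionRing.injective R k)
  have hPx : ∀ x : L, P.eval₂ f x = f b * aeval x p := by
    intro x
    rw [← eval₂_map, hbP, ← algebraMap_smul k b, smul_eq_C_mul, eval₂_mul, eval₂_C, aeval_def]
    rfl
  have hroot : ∀ x : L, aeval x p = 0 ↔ P.eval₂ f x = 0 := by
    intro x
    rw [hPx, mul_eq_zero, or_iff_right]
    exact (map_ne_zero_iff f hf).2 (nonZeroDivisors.ne_zero hb)
  simp only [hroot]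
  have hlc : f P.leadingCoeff ≠ 0 := (map_ne_zero_iff f hf).2 (leadingCoeff_ne_zero.2 hP)
  rcases Nat.eq_zero_or_pos P.natDegree with h0 | h1
  · rw [natDegree_eq_zero] at h0
    obtain ⟨c, hc⟩ := h0
    rw [← hc] at hP ⊢
    have hc0 : c ≠ 0 := by rintro rfl; simp at hP
    have : f c ≠ 0 := (map_ne_zero_iff f hf).2 hc0
    simp [integralNormalization_C hc0, this]
  · constructor
    · rintro ⟨x, hx⟩
      exact ⟨f P.leadingCoeff * x, by rw [integralNormalization_eval₂_leadingCoeff_mul h1, hx, mul_zero]⟩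
    · rintro ⟨x, hx⟩
      refine ⟨x / f P.leadingCoeff, ?_⟩
      have h2 := integralNormalization_eval₂_leadingCoeff_mul h1 f (x / f P.leadingCoeff)
      rw [mul_div_cancel₀ _ hlc] at h2
      exact (mul_eq_zero.1 (h2.symm.trans hx)).resolve_left (pow_ne_zero _ hlc)

theorem relAlgClosed_algebraicClosure (k G : Type*) [Field k] [Field G] [Algebra k G] :
    RelAlgClosed (algebraMap (algebraicClosure k G) G) := by
  intro p hp x hx
  have h : x ∈ algebraicClosure (algebraicClosure k G) G := mem_algebraicClosure_iff.2 ⟨p, hp, hx⟩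
  rw [algebraicClosure.algebraicClosure_eq_bot] at h
  exact IntermediateField.mem_bot.1 h

theorem RelAlgClosed.comp {E E' M : Type*} [Field E] [Field E'] [Field M] {σ : E →+* M} (hσ : RelAlgClosed σ)
    (e : E' ≃+* E) : RelAlgClosed (σ.comp (e : E' →+* E)) := by
  intro p hp x hx
  obtain ⟨y, rfl⟩ := hσ (p.map (e : E' →+* E)) ((Polynomial.map_ne_zero_iff e.injective).2 hp) x
    (by rwa [eval₂_map])
  exact ⟨e.symm y, by simp⟩

theorem exists_root_algebraicClosure_iff {k G : Type*} [Field k] [Field G] [Algebra k G] {p : k[X]} (hp : p ≠ 0) :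
    (∃ x : algebraicClosure k G, aeval x p = 0) ↔ ∃ x : G, aeval x p = 0 := by
  have key : ∀ x : algebraicClosure k G, aeval (algebraMap (algebraicClosure k G) G x) p = 0 ↔ aeval x p = 0 := fun x => by
    rw [aeval_algebraMap_apply, map_eq_zero]
  exact ⟨fun ⟨x, hx⟩ => ⟨_, (key x).2 hx⟩, fun ⟨x, hx⟩ =>
    ⟨⟨x, mem_algebraicClosure_iff.2 ⟨p, hp, hx⟩⟩, (key _).1 hx⟩⟩

/-- Two relatively algebraically closed embeddings extend to the relative algebraic closure of
a simple transcendental extension, provided the same monic equations are solvable over it. -/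
theorem exists_relAlgClosed_extension {E : Type*} {G₁ G₂ : Type u} [Field E] [Countable E] [Field G₁] [Field G₂]
    {i : E →+* G₁} {σ : E →+* G₂} {z : G₁} {z' : G₂} (hz : TranscendentalOver i z) (hz' : TranscendentalOver σ z')
    (h : ∀ p : E[X][X], p.Monic → ((∃ x, ev i z x p = 0) ↔ ∃ x, ev σ z' x p = 0)) :
    ∃ (E' : Subfield G₁) (σ' : E' →+* G₂) (j : E →+* E') (w : E'), Countable E' ∧ RelAlgClosed E'.subtype ∧
      RelAlgClosed σ' ∧ E'.subtype.comp j = i ∧ σ'.comp j = σ ∧ E'.subtype w = z ∧ σ' w = z' := by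
  let k := FractionRing E[X]
  have hi1 : Function.Injective (eval₂RingHom i z) := (injective_iff_map_eq_zero _).2 fun a ha => hz a ha
  have hi2 : Function.Injective (eval₂RingHom σ z') := (injective_iff_map_eq_zero _).2 fun a ha => hz' a ha
  let : Algebra k G₁ := (IsFractionRing.lift hi1).toAlgebra
  let : Algebra k G₂ := (IsFractionRing.lift hi2).toAlgebra
  have ha1 : ∀ p : E[X], algebraMap k G₁ (algebraMap E[X] k p) = p.eval₂ i z :=
    fun p => IsFractionRing.lift_algebraMap hi1 p
  have ha2 : ∀ p : E[X], algebraMap k G₂ (algebraMap E[X] k p) = p.eval₂ σ z' :=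
    fun p => IsFractionRing.lift_algebraMap hi2 p
  have hc1 : (algebraMap k G₁).comp (algebraMap E[X] k) = eval₂RingHom i z := RingHom.ext ha1
  have hc2 : (algebraMap k G₂).comp (algebraMap E[X] k) = eval₂RingHom σ z' := RingHom.ext ha2
  obtain ⟨e⟩ : Nonempty (algebraicClosure k G₁ ≃ₐ[k] algebraicClosure k G₂) := by
    refine Field.nonempty_algEquiv_of_aeval_eq_zero_eq (Set.ext fun p => ?_)
    rw [Set.mem_ofPred_eq, Set.mem_ofPred_eq]
    rcases eq_or_ne p 0 with rfl | hp
    · simp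
    rw [exists_root_algebraicClosure_iff hp, exists_root_algebraicClosure_iff hp]
    obtain ⟨q, hq, hqL⟩ := exists_monic_forall_exists_root_iff E[X] hp
    rw [hqL G₁, hqL G₂, hc1, hc2]
    exact h q hq
  have he : ∀ x : k, algebraMap (algebraicClosure k G₂) G₂ (e (algebraMap k _ x)) = algebraMap k G₂ x := fun x => by
    rw [e.commutes]; rfl
  refine ⟨(algebraicClosure k G₁).toSubfield, (algebraMap (algebraicClosure k G₂) G₂).comp (e : _ →+* _),
    (algebraMap k (algebraicClosure k G₁)).comp ((algebraMap E[X] k).comp C),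
    algebraMap k (algebraicClosure k G₁) (algebraMap E[X] k X), ?_, relAlgClosed_algebraicClosure k G₁,
    (relAlgClosed_algebraicClosure k G₂).comp e.toRingEquiv, ?_, ?_, ?_, ?_⟩
  · have hE : Countable E[X] := countable_polynomial
    have : Countable k := (IsLocalization.mk'_surjective (nonZeroDivisors E[X]) (S := k)).countable
    exact ((Algebraic.countable k G₁).mono fun x hx => mem_algebraicClosure_iff.1 hx).to_subtype
  · ext x
    exact (ha1 (C x)).trans (eval₂_C _ _)
  · ext x
    exact (he _).trans ((ha2 (C x)).trans (eval₂_C _ _))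
  · exact (ha1 X).trans (eval₂_X _ _)
  · exact (he _).trans ((ha2 X).trans (eval₂_X _ _))

open FirstOrder.Language FirstOrder.Ring

theorem realize_term_ringHom {R S α : Type*} [Ring R] [Ring S] [CompatibleRing R] [CompatibleRing S]
    (f : R →+* S) (t : Language.ring.Term α) (v : α → R) : t.realize (f ∘ v) = f (t.realize v) := by
  induction t with
  | var => rfl
  | func g ts ih =>
    simp only [Term.realize, ih]
    cases g <;> simp

open Ultrapower in
theorem HasSpecializations.exists_extension {E F : Type u} {Ω : Type*} [Field E] [CharZero E] [Countable E] [Field F] [Field Ω]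
    {ι : F →+* Ω} {N : F → Prop} (H : HasSpecializations ι N) {i σ : E →+* Ultrapower F} (hi : RelAlgClosed i)
    (hσ : RelAlgClosed σ) {z : Ultrapower F} (hz : TranscendentalOver i z) :
    ∃ (E' : Subfield (Ultrapower F)) (σ' : E' →+* Ultrapower F) (j : E →+* E') (w : E'), Countable E' ∧
      RelAlgClosed E'.subtype ∧ RelAlgClosed σ' ∧ E'.subtype.comp j = i ∧ σ'.comp j = σ ∧
      E'.subtype w = z ∧ Almost N (σ' w) := by
  obtain ⟨z', hN, hz', hroots⟩ := H.exists_sameRoots hi hσ hz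
  obtain ⟨E', σ', j, w, h1, h2, h3, h4, h5, h6, h7⟩ := exists_relAlgClosed_extension hz hz' hroots
  exact ⟨E', σ', j, w, h1, h2, h3, h4, h5, h6, h7 ▸ hN⟩

theorem HasSpecializations.exists_extension_mem_range {E F : Type u} {Ω : Type*} [Field E] [CharZero E] [Countable E]
    [Field F] [Field Ω] {ι : F →+* Ω} {N : F → Prop} (H : HasSpecializations ι N) {i σ : E →+* Ultrapower F}
    (hi : RelAlgClosed i) (hσ : RelAlgClosed σ) (z : Ultrapower F) :
    ∃ (E' : Type u) (_ : Field E') (i' σ' : E' →+* Ultrapower F) (j : E →+* E') (w : E'), CharZero E' ∧ Countable E' ∧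
      RelAlgClosed i' ∧ RelAlgClosed σ' ∧ i'.comp j = i ∧ σ'.comp j = σ ∧ i' w = z := by
  by_cases hz : z ∈ i.range
  · obtain ⟨w, hw⟩ := hz
    exact ⟨E, _, i, σ, RingHom.id E, w, ‹_›, ‹_›, hi, hσ, rfl, rfl, hw⟩
  · obtain ⟨E', σ', j, w, h1, h2, h3, h4, h5, h6, -⟩ := H.exists_extension hi hσ (hi.transcendentalOver hz)
    exact ⟨E', _, E'.subtype, σ', j, w, charZero_of_injective_ringHom j.injective, h1, h2, h3, h4, h5, h6⟩

theorem HasSpecializations.realize_iff {F : Type u} {Ω α : Type*} [Field F] [Field Ω] {ι : F →+* Ω} {N : F → Prop}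
    (H : HasSpecializations ι N) [CompatibleRing (Ultrapower F)] {n : ℕ} (φ : Language.ring.BoundedFormula α n) :
    ∀ {E : Type u} [Field E] [CharZero E] [Countable E] {i σ : E →+* Ultrapower F}, RelAlgClosed i → RelAlgClosed σ →
      ∀ (v : α → E) (x : Fin n → E), φ.Realize (i ∘ v) (i ∘ x) ↔ φ.Realize (σ ∘ v) (σ ∘ x) := by
  induction φ with
  | falsum => intros; rfl
  | equal t₁ t₂ =>
    intro E _ _ _ i σ _ _ v x
    let := compatibleRingOfRing E
    simp only [BoundedFormula.Realize, ← Sum.comp_elim, realize_term_ringHom, (RingHom.injective _).eq_iff]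
  | rel R => cases R
  | imp φ ψ ih₁ ih₂ =>
    intro E _ _ _ i σ hi hσ v x
    simp only [BoundedFormula.realize_imp, ih₁ hi hσ v x, ih₂ hi hσ v x]
  | all φ ih =>
    suffices h : ∀ {E : Type u} [Field E] [CharZero E] [Countable E] {i σ : E →+* Ultrapower F}, RelAlgClosed i →
        RelAlgClosed σ → ∀ (v : α → E) (x : Fin _ → E), φ.all.Realize (i ∘ v) (i ∘ x) →
        φ.all.Realize (σ ∘ v) (σ ∘ x) from fun {_} _ _ _ {_ _} hi hσ v x => ⟨h hi hσ v x, h hσ hi v x⟩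
    intro E _ _ _ i σ hi hσ v x h
    rw [BoundedFormula.realize_all] at h ⊢
    intro z
    obtain ⟨E', _, σ', i', j, w, _, _, hσ', hi', rfl, rfl, rfl⟩ := H.exists_extension_mem_range hσ hi z
    have := (ih hi' hσ' (j ∘ v) (Fin.snoc (j ∘ x) w)).1
    simp only [Fin.comp_snoc] at this
    exact this (h (i' w))

namespace Ultrapower

/-- Łoś's theorem. -/
theorem realize_boundedFormula_mk {F α : Type*} [Field F] [CompatibleRing F] [CompatibleRing (Ultrapower F)] {n : ℕ}
    (φ : Language.ring.BoundedFormula α n) (v : α → ℕ → F) (x : Fin n → ℕ → F) :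
    φ.Realize (fun a => mk F (v a)) (fun a => mk F (x a)) ↔
      ∀ᶠ k in μ, φ.Realize (fun a => v a k) (fun a => x a k) := by
  induction φ with
  | falsum => simpa [BoundedFormula.Realize] using μ.neBot.ne
  | equal t₁ t₂ =>
    let := compatibleRingOfRing (ℕ → F)
    have h1 : ∀ t : Language.ring.Term (α ⊕ Fin _), t.realize (Sum.elim (fun a => mk F (v a)) fun a => mk F (x a)) =
        mk F fun k => t.realize (Sum.elim (fun a => v a k) fun a => x a k) := by
      intro t
      have h2 := realize_term_ringHom (mk F) t (Sum.elim v x)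
      rw [Sum.comp_elim] at h2
      refine h2.trans (congrArg (mk F) (funext fun k => ?_))
      have h3 := realize_term_ringHom (proj F k) t (Sum.elim v x)
      rw [Sum.comp_elim] at h3
      exact h3.symm
    simp only [BoundedFormula.Realize, h1, mk_eq_mk]
  | rel R => cases R
  | imp φ ψ ih₁ ih₂ =>
    simp only [BoundedFormula.realize_imp, ih₁, ih₂, Ultrafilter.eventually_imp]
  | all φ ih =>
    simp only [BoundedFormula.realize_all]
    have h1 : ∀ z : ℕ → F, φ.Realize (fun a => mk F (v a)) (Fin.snoc (fun a => mk F (x a)) (mk F z)) ↔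
        ∀ᶠ k in μ, φ.Realize (fun a => v a k) (Fin.snoc (fun a => x a k) (z k)) := by
      intro z
      have h2 := ih (Fin.snoc x z)
      have h3 : (fun a => mk F ((Fin.snoc x z : Fin _ → ℕ → F) a)) = Fin.snoc (fun a => mk F (x a)) (mk F z) :=
        Fin.comp_snoc (mk F) x z
      have h4 : ∀ k, (fun a => (Fin.snoc x z : Fin _ → ℕ → F) a k) = Fin.snoc (fun a => x a k) (z k) := fun k =>
        Fin.comp_snoc (proj F k) x z
      simpa only [h3, h4] using h2
    constructor
    · intro h
      by_contra hcon
      rw [← Ultrafilter.eventually_not] at hcon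
      simp only [not_forall] at hcon
      obtain ⟨z, hz⟩ := hcon.choice
      obtain ⟨k, h5, h6⟩ := (hz.and ((h1 z).1 (h (mk F z)))).exists
      exact h5 h6
    · intro h z
      obtain ⟨z, rfl⟩ := mk_surjective z
      exact (h1 z).2 (h.mono fun k hk => hk (z k))

theorem realize_formula_mk {F α : Type*} [Field F] [CompatibleRing F] [CompatibleRing (Ultrapower F)]
    (φ : Language.ring.Formula α) (v : α → ℕ → F) :
    φ.Realize (fun a => mk F (v a)) ↔ ∀ᶠ k in μ, φ.Realize fun a => v a k := by
  have h := realize_boundedFormula_mk φ v default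
  rw [Subsingleton.elim (fun a : Fin 0 => mk F _) default] at h
  refine h.trans (Filter.eventually_congr (Filter.Eventually.of_forall fun k => ?_))
  rw [Subsingleton.elim (fun a : Fin 0 => _) default]
  rfl

variable (F : Type*) [Field F]

/-- The diagonal embedding. -/
def diag : F →+* Ultrapower F := (mk F).comp (Pi.constRingHom ℕ F)

theorem relAlgClosed_diag : RelAlgClosed (diag F) := by
  intro p hp x hx
  obtain ⟨a, rfl⟩ := mk_surjective x
  have h1 : p.eval₂ (diag F) (mk F a) = mk F fun k => p.eval (a k) := by
    rw [diag, ← hom_eval₂]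
    refine congrArg (mk F) (funext fun k => ?_)
    exact (hom_eval₂ p (Pi.constRingHom ℕ F) (proj F k) a)
  rw [h1, mk_eq_zero] at hx
  by_contra hcon
  classical
  have h2 : ∀ᶠ k in μ, ∀ b ∈ p.roots.toFinset, a k ≠ b := by
    rw [Filter.eventually_all_finset]
    intro b _
    rw [Ultrafilter.eventually_not]
    exact fun h => hcon ⟨b, mk_eq_mk.2 (h.mono fun _ h => h.symm)⟩
  obtain ⟨k, h3, h4⟩ := (hx.and h2).exists
  exact h4 (a k) (by simpa [hp] using h3) rfl

theorem mk_natCast_notMem_range [CharZero F] : mk F (fun k => (k : F)) ∉ (diag F).range := by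
  rintro ⟨b, hb⟩
  have h1 : ∀ᶠ k : ℕ in μ, b = k := mk_eq_mk.1 hb
  obtain ⟨m, hm⟩ := h1.exists
  have h2 : ∀ᶠ k : ℕ in μ, k ≠ m := Filter.hyperfilter_le_cofinite (Set.finite_singleton m).compl_mem_cofinite
  obtain ⟨k, h3, h4⟩ := (h1.and h2).exists
  exact h4 (Nat.cast_injective (h3.symm.trans hm))

end Ultrapower

open Ultrapower in
theorem HasSpecializations.not_definableIn {F : Type u} {Ω : Type*} [Field F] [CharZero F] [Countable F] [Field Ω]
    {ι : F →+* Ω} (H : HasSpecializations ι fun t : F => ¬ IsIntegral ℤ t) : ¬ DefinableIn F (ringOfIntegers F) := by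
  let := compatibleRingOfRing F
  let := compatibleRingOfRing (Ultrapower F)
  intro h
  obtain ⟨φ, hφ⟩ := Set.definable_iff_exists_formula_sum.1 h
  have hφ' : ∀ t : F, IsIntegral ℤ t ↔ φ.Realize (Sum.elim (fun a => (a : F)) fun _ => t) := fun t =>
    iff_of_eq (congrFun hφ fun _ => t)
  have hd := relAlgClosed_diag F
  obtain ⟨E', σ', j, w, _, h2, h3, h4, h5, h6, h7⟩ :=
    H.exists_extension hd hd (hd.transcendentalOver (mk_natCast_notMem_range F))
  have : CharZero E' := charZero_of_injective_ringHom j.injective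
  obtain ⟨c, hc, hcN⟩ := h7
  have key : ∀ (τ : E' →+* Ultrapower F) (a : ℕ → F), τ.comp j = diag F → τ w = mk F a →
      (φ.Realize (τ ∘ Sum.elim (fun a : (Set.univ : Set F) => j a) fun _ => w) ↔ ∀ᶠ k in μ, IsIntegral ℤ (a k)) := by
    intro τ a hτ ha
    simp only [hφ']
    have h8 : (τ ∘ Sum.elim (fun a : (Set.univ : Set F) => j a) fun _ : Fin 1 => w) =
      fun s => mk F ((Sum.elim (fun a k => (a : F)) fun _ => a : (Set.univ : Set F) ⊕ Fin 1 → ℕ → F) s) := by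
      ext s
      rcases s with s | s
      · exact RingHom.congr_fun hτ s
      · exact ha
    rw [h8, realize_formula_mk]
    refine Filter.eventually_congr (Filter.Eventually.of_forall fun k => iff_of_eq (congrArg φ.Realize ?_))
    ext (s | s) <;> rfl
  have h9 := (key _ _ h4 h6).2 (Filter.Eventually.of_forall fun k => isIntegral_natCast k)
  have h10 := (H.realize_iff φ h2 h3 (Sum.elim (fun a : (Set.univ : Set F) => j a) fun _ => w) default).1
  rw [Subsingleton.elim (_ ∘ default) default, Subsingleton.elim (_ ∘ default) default] at h10
  obtain ⟨k, h11, h12⟩ := (((key _ _ h5 hc.symm).1 (h10 h9)).and hcN).exists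
  exact h12 h11

end

/-- The set of subfields `F` of `Q̄` in which the ring of integers `𝒪_F` is definable
(by a first-order formula in the language of rings with parameters from `F`)
is meager in the space `𝓔` of all subfields of `Q̄`. -/
theorem meager_ringOfIntegers_definable :
    IsMeagre {F : Subfield Qbar | DefinableIn F (ringOfIntegers F)} := by
  refine isMeagre_not_hasSpecializations.mono ?_
  intro F hF hsp
  have : Algebra.IsAlgebraic ℚ Qbar := AlgebraicClosure.isAlgebraic ℚ
  have : Countable Qbar := Cardinal.mk_le_aleph0_iff.1
    ((Algebra.IsAlgebraic.cardinalMk_le_max ℚ Qbar).trans (by simp))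
  have : Countable F := Subtype.countable
  exact hsp.not_definableIn hF
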